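/- Let A be a commutative noetherian local ring, 𝔞 an ideal, x = x_1,…,x_t ∈ A with dim A/(x) ≤ 3, and M an 𝔞-cofinite A-module. Then Hom_A(A/𝔞, H^i(x,M)) is finitely generated for all i ≤ n+1 if and only if H^i(x,M) is 𝔞-cofinite for all i ≤ n. -/

import Mathlib

open CategoryTheory Limits

noncomputable section

variable {A : Type} [CommRing A]

/-- The `i`-th term of the Koszul cochain complex `Hom_A(K_•(x), M)`. -/
abbrev KoszulCochain {t : ℕ} (x : Fin t → A) (M : Type) [AddCommGroup M] [Module A M]
    (i : ℕ) : Type :=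
  {s : Finset (Fin t) // s.card = i} → M

/-- The Koszul cochain differential. -/
def koszulD {t : ℕ} (x : Fin t → A) (M : Type) [AddCommGroup M] [Module A M] (i : ℕ) :
    KoszulCochain x M i →ₗ[A] KoszulCochain x M (i + 1) :=
  LinearMap.pi fun s => ∑ j ∈ s.1.attach,
    (((-1 : A) ^ ((s.1.filter (fun k => k < j.1)).card)) * x j.1) •
      (LinearMap.proj
        (⟨s.1.erase j.1, by simp [Finset.card_erase_of_mem j.2, s.2]⟩ :
          {s : Finset (Fin t) // s.card = i}) :
        KoszulCochain x M i →ₗ[A] M)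

/-- The boundaries in degree `i` of the Koszul cochain complex. -/
def koszulBoundary {t : ℕ} (x : Fin t → A) (M : Type) [AddCommGroup M] [Module A M] :
    (i : ℕ) → Submodule A (KoszulCochain x M i)
  | 0 => ⊥
  | j + 1 => LinearMap.range (koszulD x M j)

/-- The `i`-th Koszul cohomology `H^i(x, M)` of `M` with respect to `x`. -/
abbrev KoszulCohomology {t : ℕ} (x : Fin t → A) (M : Type) [AddCommGroup M] [Module A M]
    (i : ℕ) : Type :=
  LinearMap.ker (koszulD x M i) ⧸
    (koszulBoundary x M i).comap (LinearMap.ker (koszulD x M i)).subtype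

/-- `Ext_A^i(A/𝔞, M)` as an `A`-module. -/
abbrev extQuot (𝔞 : Ideal A) (M : Type) [AddCommGroup M] [Module A M] (i : ℕ) : Type :=
  ↥(((_root_.Ext A (ModuleCat A) i).obj
    (Opposite.op (ModuleCat.of A (A ⧸ 𝔞)))).obj (ModuleCat.of A M))

/-- `M` is an `𝔞`-cofinite `A`-module: `Supp M ⊆ V(𝔞)` and all `Ext_A^i(A/𝔞, M)`
are finitely generated. -/
def IsCofinite (𝔞 : Ideal A) (M : Type) [AddCommGroup M] [Module A M] : Prop :=
  Module.support A M ⊆ PrimeSpectrum.zeroLocus (𝔞 : Set A) ∧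
    ∀ i : ℕ, Module.Finite A (extQuot 𝔞 M i)

/-! ### A module-level wrapper around `Abelian.Ext` -/

/-- `Ext^i_A(N, M)` -/
abbrev EX (A : Type) [CommRing A] (N M : Type) [AddCommGroup N] [Module A N] [AddCommGroup M]
    [Module A M] (i : ℕ) : Type :=
  Abelian.Ext (ModuleCat.of A N) (ModuleCat.of A M) i

section EXsec

variable {N N' N'' M M' M'' : Type} [AddCommGroup N] [Module A N] [AddCommGroup N'] [Module A N']
  [AddCommGroup N''] [Module A N''] [AddCommGroup M] [Module A M] [AddCommGroup M'] [Module A M']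
  [AddCommGroup M''] [Module A M'']

/-- covariant functoriality -/
def EX.post (N : Type) [AddCommGroup N] [Module A N] (f : M →ₗ[A] M') (i : ℕ) :
    EX A N M i →ₗ[A] EX A N M' i :=
  (Abelian.Ext.mk₀ (ModuleCat.ofHom f)).postcompOfLinear A (ModuleCat.of A N) (add_zero i)

/-- contravariant functoriality -/
def EX.pre (g : N' →ₗ[A] N) (M : Type) [AddCommGroup M] [Module A M] (i : ℕ) :
    EX A N M i →ₗ[A] EX A N' M i :=
  (Abelian.Ext.mk₀ (ModuleCat.ofHom g)).precompOfLinear A (ModuleCat.of A M) (zero_add i)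

/-- Short exact sequences. -/
structure SES (f : M' →ₗ[A] M) (g : M →ₗ[A] M'') : Prop where
  inj : Function.Injective f
  ex : Function.Exact f g
  surj : Function.Surjective g

/-- the associated short complex -/
abbrev SES.cx {f : M' →ₗ[A] M} {g : M →ₗ[A] M''} (h : SES f g) : ShortComplex (ModuleCat A) :=
  ShortComplex.mk (ModuleCat.ofHom f) (ModuleCat.ofHom g)
      (by ext x; exact h.ex.apply_apply_eq_zero x)

theorem SES.short {f : M' →ₗ[A] M} {g : M →ₗ[A] M''} (h : SES f g) : h.cx.ShortExact :=
  ModuleCat.shortComplex_shortExact _ h.ex h.inj h.surj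

/-- connecting map, covariant -/
def EX.dco {f : M' →ₗ[A] M} {g : M →ₗ[A] M''} (h : SES f g) (N : Type) [AddCommGroup N]
    [Module A N] (i : ℕ) : EX A N M'' i →ₗ[A] EX A N M' (i + 1) :=
  h.short.extClass.postcompOfLinear A (ModuleCat.of A N) rfl

/-- connecting map, contravariant -/
def EX.dcon {f : N' →ₗ[A] N} {g : N →ₗ[A] N''} (h : SES f g) (M : Type) [AddCommGroup M]
    [Module A M] (i : ℕ) : EX A N' M i →ₗ[A] EX A N'' M (i + 1) :=
  h.short.extClass.precompOfLinear A (ModuleCat.of A M) (add_comm 1 i)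

theorem EX.post_comp (f : M →ₗ[A] M') (g : M' →ₗ[A] M'') (i : ℕ) (x : EX A N M i) :
    EX.post N (g ∘ₗ f) i x = EX.post N g i (EX.post N f i x) := by
  change Abelian.Ext.comp x _ (by lia) = Abelian.Ext.comp (Abelian.Ext.comp x _ (by lia)) _ (by lia)
  rw [Abelian.Ext.comp_assoc (a₂₃ := 0) _ _ _ (by lia) (by lia) (by simp), Abelian.Ext.mk₀_comp_mk₀]
  rfl

theorem EX.pre_comp (f : N →ₗ[A] N') (g : N' →ₗ[A] N'') (i : ℕ) (x : EX A N'' M i) :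
    EX.pre (g ∘ₗ f) M i x = EX.pre f M i (EX.pre g M i x) := by
  change Abelian.Ext.comp _ x (by lia) = Abelian.Ext.comp _ (Abelian.Ext.comp _ x (by lia)) (by lia)
  rw [← Abelian.Ext.comp_assoc (a₁₂ := 0) _ _ _ (by lia) (by lia) (by simp), Abelian.Ext.mk₀_comp_mk₀]
  rfl

theorem EX.post_id (i : ℕ) (x : EX A N M i) : EX.post N (LinearMap.id : M →ₗ[A] M) i x = x := by
  change Abelian.Ext.comp x _ (by lia) = x
  exact Abelian.Ext.comp_mk₀_id x

theorem EX.pre_id (i : ℕ) (x : EX A N M i) : EX.pre (LinearMap.id : N →ₗ[A] N) M i x = x := by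
  change Abelian.Ext.comp _ x (by lia) = x
  exact Abelian.Ext.mk₀_id_comp x

theorem EX.post_smul_id (r : A) (i : ℕ) (x : EX A N M i) :
    EX.post N (r • (LinearMap.id : M →ₗ[A] M)) i x = r • x := by
  change Abelian.Ext.comp x _ (by lia) = _
  exact (Abelian.Ext.smul_eq_comp_mk₀ (R := A) (X := ModuleCat.of A N) x r).symm

theorem EX.pre_smul_id (r : A) (i : ℕ) (x : EX A N M i) :
    EX.pre (r • (LinearMap.id : N →ₗ[A] N)) M i x = r • x := by
  change Abelian.Ext.comp (Abelian.Ext.mk₀ (r • 𝟙 (ModuleCat.of A N))) x (by lia) = _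
  rw [Abelian.Ext.mk₀_smul, Abelian.Ext.smul_comp, Abelian.Ext.mk₀_id_comp]

theorem EX.post_zero (i : ℕ) (x : EX A N M i) : EX.post N (0 : M →ₗ[A] M') i x = 0 := by
  change Abelian.Ext.comp x (Abelian.Ext.mk₀ 0) (by lia) = 0
  rw [Abelian.Ext.mk₀_zero, Abelian.Ext.comp_zero]

theorem EX.pre_zero (i : ℕ) (x : EX A N M i) : EX.pre (0 : N' →ₗ[A] N) M i x = 0 := by
  change Abelian.Ext.comp (Abelian.Ext.mk₀ 0) x (by lia) = 0
  rw [Abelian.Ext.mk₀_zero, Abelian.Ext.zero_comp]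

theorem EX.pre_post (g : N' →ₗ[A] N) (f : M →ₗ[A] M') (i : ℕ) (x : EX A N M i) :
    EX.pre g M' i (EX.post N f i x) = EX.post N' f i (EX.pre g M i x) := by
  change Abelian.Ext.comp _ (Abelian.Ext.comp x _ (by lia)) (by lia) = Abelian.Ext.comp (Abelian.Ext.comp _ x (by lia)) _ (by lia)
  rw [Abelian.Ext.comp_assoc (a₂₃ := i) _ _ _ (by lia) (by lia) (by simp)]

theorem EX.pre_dco {f : M' →ₗ[A] M} {g : M →ₗ[A] M''} (h : SES f g) (u : N' →ₗ[A] N) (i : ℕ)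
    (x : EX A N M'' i) :
    EX.pre u M' (i + 1) (EX.dco h N i x) = EX.dco h N' i (EX.pre u M'' i x) := by
  change Abelian.Ext.comp _ (Abelian.Ext.comp x _ (by lia)) (by lia) = Abelian.Ext.comp (Abelian.Ext.comp _ x (by lia)) _ (by lia)
  rw [Abelian.Ext.comp_assoc (a₂₃ := i + 1) _ _ _ (by lia) (by lia) (by simp)]

theorem EX.dcon_post {f : N' →ₗ[A] N} {g : N →ₗ[A] N''} (h : SES f g) (u : M →ₗ[A] M') (i : ℕ)
    (x : EX A N' M i) :
    EX.dcon h M' i (EX.post N' u i x) = EX.post N'' u (i + 1) (EX.dcon h M i x) := by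
  change Abelian.Ext.comp _ (Abelian.Ext.comp x _ (by lia)) (by lia) = Abelian.Ext.comp (Abelian.Ext.comp _ x (by lia)) _ (by lia)
  rw [Abelian.Ext.comp_assoc (a₂₃ := i) _ _ _ (by lia) (by lia) (by lia)]

theorem EX.dcon_nat {P P' P'' : Type} [AddCommGroup P] [Module A P] [AddCommGroup P'] [Module A P']
    [AddCommGroup P''] [Module A P''] {f : N' →ₗ[A] N} {g : N →ₗ[A] N''} (h : SES f g)
    {f' : P' →ₗ[A] P} {g' : P →ₗ[A] P''} (h' : SES f' g') (a : N' →ₗ[A] P') (b : N →ₗ[A] P)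
    (c : N'' →ₗ[A] P'') (h1 : b ∘ₗ f = f' ∘ₗ a) (h2 : c ∘ₗ g = g' ∘ₗ b) (i : ℕ)
    (x : EX A P' M i) :
    EX.dcon h M i (EX.pre a M i x) = EX.pre c M (i + 1) (EX.dcon h' M i x) := by
  change Abelian.Ext.comp _ (Abelian.Ext.comp _ x (by lia)) (by lia) = Abelian.Ext.comp _ (Abelian.Ext.comp _ x (by lia)) (by lia)
  rw [← Abelian.Ext.comp_assoc (a₁₂ := 1) _ _ _ (by lia) (by lia) (by lia),
    ← Abelian.Ext.comp_assoc (a₁₂ := 1) _ _ _ (by lia) (by lia) (by lia)]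
  congr 1
  exact ShortComplex.ShortExact.extClass_naturality h.short h'.short
    { τ₁ := ModuleCat.ofHom a, τ₂ := ModuleCat.ofHom b, τ₃ := ModuleCat.ofHom c
      comm₁₂ := by ext x; exact (LinearMap.congr_fun h1 x).symm
      comm₂₃ := by ext x; exact (LinearMap.congr_fun h2 x).symm }

section
variable {f : M' →ₗ[A] M} {g : M →ₗ[A] M''} (h : SES f g) (N : Type) [AddCommGroup N]
    [Module A N] (i : ℕ)

theorem EX.co2 {f : M' →ₗ[A] M} {g : M →ₗ[A] M''} (h : SES f g) (N : Type) [AddCommGroup N]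
    [Module A N] (i : ℕ) : Function.Exact (EX.post N f i) (EX.post N g i) := by
  intro x
  constructor
  · intro hx
    exact Abelian.Ext.covariant_sequence_exact₂ _ h.short x hx
  · rintro ⟨y, rfl⟩
    rw [← EX.post_comp, h.ex.linearMap_comp_eq_zero, EX.post_zero]

theorem EX.co3 : Function.Exact (EX.post N g i) (EX.dco h N i) := by
  intro x
  constructor
  · intro hx
    exact Abelian.Ext.covariant_sequence_exact₃ _ h.short x rfl hx
  · rintro ⟨y, rfl⟩
    change Abelian.Ext.comp (Abelian.Ext.comp y (Abelian.Ext.mk₀ h.cx.g) (by lia)) _ (by lia) = 0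
    rw [Abelian.Ext.comp_assoc (a₂₃ := 1) _ _ _ (by lia) (by lia) (by simp),
      ShortComplex.ShortExact.comp_extClass, Abelian.Ext.comp_zero]

theorem EX.co1 : Function.Exact (EX.dco h N i) (EX.post N f (i + 1)) := by
  intro x
  constructor
  · intro hx
    exact Abelian.Ext.covariant_sequence_exact₁ _ h.short x hx rfl
  · rintro ⟨y, rfl⟩
    change Abelian.Ext.comp (Abelian.Ext.comp y _ (by lia)) (Abelian.Ext.mk₀ h.cx.f)  (by lia) = 0
    rw [Abelian.Ext.comp_assoc (a₂₃ := 1) _ _ _ (by lia) (by lia) (by simp),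
      ShortComplex.ShortExact.extClass_comp, Abelian.Ext.comp_zero]
end

section
variable {f : N' →ₗ[A] N} {g : N →ₗ[A] N''} (h : SES f g) (M : Type) [AddCommGroup M]
    [Module A M] (i : ℕ)

theorem EX.con2 {f : N' →ₗ[A] N} {g : N →ₗ[A] N''} (h : SES f g) (M : Type) [AddCommGroup M]
    [Module A M] (i : ℕ) : Function.Exact (EX.pre g M i) (EX.pre f M i) := by
  intro x
  constructor
  · intro hx
    exact Abelian.Ext.contravariant_sequence_exact₂ h.short _ x hx
  · rintro ⟨y, rfl⟩
    rw [← EX.pre_comp, h.ex.linearMap_comp_eq_zero, EX.pre_zero]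

theorem EX.con1 : Function.Exact (EX.pre f M i) (EX.dcon h M i) := by
  intro x
  constructor
  · intro hx
    exact Abelian.Ext.contravariant_sequence_exact₁ h.short _ x (by lia) hx
  · rintro ⟨y, rfl⟩
    change Abelian.Ext.comp _ (Abelian.Ext.comp (Abelian.Ext.mk₀ h.cx.f) y (by lia)) (by lia) = 0
    rw [← Abelian.Ext.comp_assoc (a₁₂ := 1) _ _ _ (by lia) (by lia) (by lia),
      ShortComplex.ShortExact.extClass_comp, Abelian.Ext.zero_comp]

theorem EX.con3 : Function.Exact (EX.dcon h M i) (EX.pre g M (i + 1)) := by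
  intro x
  constructor
  · intro hx
    exact Abelian.Ext.contravariant_sequence_exact₃ h.short _ x hx (by lia)
  · rintro ⟨y, rfl⟩
    change Abelian.Ext.comp (Abelian.Ext.mk₀ h.cx.g) (Abelian.Ext.comp _ y (by lia))  (by lia) = 0
    rw [← Abelian.Ext.comp_assoc (a₁₂ := 1) _ _ _ (by lia) (by lia) (by lia),
      ShortComplex.ShortExact.comp_extClass, Abelian.Ext.zero_comp]
end

/-- degree zero -/
def EX.zeroEquiv : EX A N M 0 ≃ₗ[A] (N →ₗ[A] M) :=
  (Abelian.Ext.linearEquiv₀ (R := A) (X := ModuleCat.of A N) (Y := ModuleCat.of A M)).trans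
    ModuleCat.homLinearEquiv

theorem EX.zeroEquiv_symm_pre (u : N' →ₗ[A] N) (f : N →ₗ[A] M) :
    EX.pre u M 0 (EX.zeroEquiv.symm f) = EX.zeroEquiv.symm (f ∘ₗ u) := by
  change Abelian.Ext.comp (Abelian.Ext.mk₀ _) (Abelian.Ext.mk₀ (ModuleCat.ofHom f)) (by lia) = _
  rw [Abelian.Ext.mk₀_comp_mk₀]
  rfl

theorem EX.zeroEquiv_symm_post (u : M →ₗ[A] M') (f : N →ₗ[A] M) :
    EX.post N u 0 (EX.zeroEquiv.symm f) = EX.zeroEquiv.symm (u ∘ₗ f) := by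
  change Abelian.Ext.comp (Abelian.Ext.mk₀ (ModuleCat.ofHom f)) (Abelian.Ext.mk₀ _) (by lia) = _
  rw [Abelian.Ext.mk₀_comp_mk₀]
  rfl

theorem EX.post_inj (f : M →ₗ[A] M') (hf : Function.Injective f) :
    Function.Injective (EX.post N f 0) := by
  rw [← LinearMap.ker_eq_bot, LinearMap.ker_eq_bot']
  intro x hx
  obtain ⟨x, rfl⟩ := EX.zeroEquiv.symm.surjective x
  rw [EX.zeroEquiv_symm_post] at hx
  rw [LinearEquiv.map_eq_zero_iff] at hx ⊢
  ext y
  exact hf (by simpa using LinearMap.congr_fun hx y)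

theorem EX.pre_inj (f : N' →ₗ[A] N) (hf : Function.Surjective f) :
    Function.Injective (EX.pre f M 0) := by
  rw [← LinearMap.ker_eq_bot, LinearMap.ker_eq_bot']
  intro x hx
  obtain ⟨x, rfl⟩ := EX.zeroEquiv.symm.surjective x
  rw [EX.zeroEquiv_symm_pre] at hx
  rw [LinearEquiv.map_eq_zero_iff] at hx ⊢
  ext y
  obtain ⟨y, rfl⟩ := hf y
  simpa using LinearMap.congr_fun hx y

theorem EX.proj [Module.Projective A N] (i : ℕ) (x : EX A N M (i + 1)) : x = 0 := by
  have : Projective (ModuleCat.of A N) := inferInstance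
  exact Abelian.Ext.eq_zero_of_projective _

end EXsec

/-! ### Serre classes -/

/-- A Serre class of modules. -/
structure SerreCl (A : Type) [CommRing A] where
  mem : (M : Type) → [AddCommGroup M] → [Module A M] → Prop
  zero : ∀ (M : Type) [AddCommGroup M] [Module A M] [Subsingleton M], mem M
  mid : ∀ {M' M M'' : Type} [AddCommGroup M'] [Module A M'] [AddCommGroup M] [Module A M]
    [AddCommGroup M''] [Module A M''] (f : M' →ₗ[A] M) (g : M →ₗ[A] M''),
    Function.Exact f g → mem M' → mem M'' → mem M

namespace SerreCl

variable (C : SerreCl A) {N N' N'' M M' M'' : Type} [AddCommGroup N] [Module A N]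
  [AddCommGroup N'] [Module A N']
  [AddCommGroup N''] [Module A N''] [AddCommGroup M] [Module A M] [AddCommGroup M'] [Module A M']
  [AddCommGroup M''] [Module A M'']

theorem of_inj (f : M →ₗ[A] M') (hf : Function.Injective f) (h : C.mem M') : C.mem M := by
  refine C.mid (0 : PUnit →ₗ[A] M) f ?_ (C.zero _) h
  intro x
  constructor
  · intro hx
    exact ⟨0, by simpa using (hf (by simpa using hx.symm))⟩
  · rintro ⟨y, rfl⟩
    simp

theorem of_surj (f : M →ₗ[A] M') (hf : Function.Surjective f) (h : C.mem M) : C.mem M' := by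
  refine C.mid f (0 : M' →ₗ[A] PUnit) ?_ h (C.zero _)
  intro x
  simp [hf x]

theorem of_equiv (f : M ≃ₗ[A] M') (h : C.mem M) : C.mem M' :=
  C.of_surj f.toLinearMap f.surjective h

theorem of_sub (L : Submodule A M) (h : C.mem M) : C.mem L := C.of_inj L.subtype
  L.subtype_injective h

theorem of_quot (L : Submodule A M) (h : C.mem M) : C.mem (M ⧸ L) := C.of_surj L.mkQ
  L.mkQ_surjective h

theorem prod (h : C.mem M) (h' : C.mem M') : C.mem (M × M') :=
  C.mid (LinearMap.inl A M M') (LinearMap.snd A M M') Function.Exact.inl_snd h h'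

theorem pi (h : C.mem M) (s : ℕ) : C.mem (Fin s → M) := by
  induction s with
  | zero => exact C.zero _
  | succ n ih =>
    exact C.of_equiv (Fin.consLinearEquiv A (fun _ : Fin (n + 1) => M)) (C.prod h ih)

theorem _root_.exists_pres (N : Type) [AddCommGroup N] [Module A N] [Module.Finite A N] :
    ∃ (s : ℕ) (g : (Fin s → A) →ₗ[A] N), SES (LinearMap.ker g).subtype g := by
  obtain ⟨s, g, hg⟩ := Module.Finite.exists_fin' A N
  exact ⟨s, g, Submodule.subtype_injective _, LinearMap.exact_subtype_ker_map g, hg⟩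

theorem _root_.SES.quot (L : Submodule A M) : SES L.subtype L.mkQ :=
  ⟨L.subtype_injective, LinearMap.exact_subtype_mkQ L, L.mkQ_surjective⟩

theorem ext [IsNoetherianRing A] (h : C.mem M) (i : ℕ) :
    ∀ (N : Type) [AddCommGroup N] [Module A N] [Module.Finite A N], C.mem (EX A N M i) := by
  induction i with
  | zero =>
    intro N _ _ _
    obtain ⟨s, g, hg⟩ := exists_pres (A := A) N
    refine C.of_inj (EX.pre g M 0) (EX.pre_inj g hg.surj) ?_
    refine C.of_equiv EX.zeroEquiv.symm ?_
    exact C.of_equiv ((Pi.basisFun A (Fin s)).constr A (M' := M)) (C.pi h s)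
  | succ i ih =>
    intro N _ _ _
    obtain ⟨s, g, hg⟩ := exists_pres (A := A) N
    refine C.of_surj (EX.dcon hg M i) ?_ (ih _)
    intro x
    exact (EX.con3 hg M i x).1 (EX.proj i _)

theorem _root_.SES.kerOf (g : M →ₗ[A] M'') (hg : Function.Surjective g) :
    SES (LinearMap.ker g).subtype g :=
  ⟨Submodule.subtype_injective _, LinearMap.exact_subtype_ker_map g, hg⟩

/-- Ext along an isomorphism in the first variable. -/
def _root_.EX.preEquiv (e : N ≃ₗ[A] N') (M : Type) [AddCommGroup M] [Module A M] (i : ℕ) :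
    EX A N' M i ≃ₗ[A] EX A N M i :=
  LinearEquiv.ofLinearMap (EX.pre e.toLinearMap M i) (EX.pre e.symm.toLinearMap M i)
    (by ext x; simp [← EX.pre_comp, EX.pre_id]) (by ext x; simp [← EX.pre_comp, EX.pre_id])

/-- Ext along an isomorphism in the second variable. -/
def _root_.EX.postEquiv (N : Type) [AddCommGroup N] [Module A N] (e : M ≃ₗ[A] M') (i : ℕ) :
    EX A N M i ≃ₗ[A] EX A N M' i :=
  LinearEquiv.ofLinearMap (EX.post N e.toLinearMap i) (EX.post N e.symm.toLinearMap i)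
    (by ext x; simp [← EX.post_comp, EX.post_id]) (by ext x; simp [← EX.post_comp, EX.post_id])

theorem _root_.EX.smul_eq_zero_left {a : A} (ha : a ∈ Module.annihilator A N) (i : ℕ)
    (x : EX A N M i) : a • x = 0 := by
  rw [← EX.pre_smul_id]
  have : a • (LinearMap.id : N →ₗ[A] N) = 0 := by
    ext n
    simpa using Module.mem_annihilator.1 ha n
  rw [this, EX.pre_zero]

theorem _root_.EX.smul_eq_zero_right {a : A} (ha : a ∈ Module.annihilator A M) (i : ℕ)
    (x : EX A N M i) : a • x = 0 := by
  rw [← EX.post_smul_id]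
  have : a • (LinearMap.id : M →ₗ[A] M) = 0 := by
    ext n
    simpa using Module.mem_annihilator.1 ha n
  rw [this, EX.post_zero]

theorem _root_.EX.smul_bij_right {a : A} (ha : Function.Bijective fun m : M => a • m) (i : ℕ) :
    Function.Bijective fun x : EX A N M i => a • x := by
  let e : M ≃ₗ[A] M := LinearEquiv.ofBijective (a • (LinearMap.id : M →ₗ[A] M)) ha
  have := (EX.postEquiv N e i).bijective
  convert this using 1
  ext x
  exact (EX.post_smul_id a i x).symm

theorem _root_.EX.eq_zero_of {a : A} (ha : Function.Bijective fun m : M => a • m)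
    (hN : a ∈ Module.annihilator A N) (i : ℕ) (x : EX A N M i) : x = 0 := by
  apply (EX.smul_bij_right ha i).1
  simp only [smul_zero]
  exact EX.smul_eq_zero_left hN i x

theorem _root_.EX.eq_zero_of_subsingleton_left [Subsingleton N] (i : ℕ) (x : EX A N M i) :
    x = 0 := by
  rw [← EX.pre_id i x, Subsingleton.elim (LinearMap.id : N →ₗ[A] N) 0, EX.pre_zero]

theorem _root_.EX.eq_zero_of_subsingleton_right [Subsingleton M] (i : ℕ) (x : EX A N M i) :
    x = 0 := by
  rw [← EX.post_id i x, Subsingleton.elim (LinearMap.id : M →ₗ[A] M) 0, EX.post_zero]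

theorem ext_of_prime [IsNoetherianRing A] (𝔞 : Ideal A) (j : ℕ)
    (h : ∀ p : Ideal A, p.IsPrime → 𝔞 ≤ p → C.mem (EX A (A ⧸ p) M j))
    (N : Type) [AddCommGroup N] [Module A N] [Module.Finite A N] (l : ℕ)
    (hl : 𝔞 ^ l ≤ Module.annihilator A N) : C.mem (EX A N M j) := by
  induction ‹Module.Finite A N› using
      IsNoetherianRing.induction_on_isQuotientEquivQuotientPrime A with
  | subsingleton N =>
    have : Subsingleton (EX A N M j) :=
      ⟨fun a b => by rw [EX.eq_zero_of_subsingleton_left j a, EX.eq_zero_of_subsingleton_left j b]⟩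
    exact C.zero _
  | quotient N p e =>
    refine C.of_equiv (EX.preEquiv e M j) (h p.1 p.2 ?_)
    rw [e.annihilator_eq, Ideal.annihilator_quotient] at hl
    exact Ideal.IsPrime.le_of_pow_le hl
  | exact N₁ N₂ N₃ f g hf hg hfg h1 h2 =>
    refine C.mid (EX.pre g M j) (EX.pre f M j) (EX.con2 ⟨hf, hfg, hg⟩ M j) ?_ ?_
    · exact h2 (hl.trans (LinearMap.annihilator_le_of_surjective g hg))
    · exact h1 (hl.trans (LinearMap.annihilator_le_of_injective f hf))

theorem _root_.factor_surj {I J : Ideal A} (h : I ≤ J) :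
    Function.Surjective (Submodule.factor h : A ⧸ I →ₗ[A] A ⧸ J) := by
  intro x
  obtain ⟨y, rfl⟩ := Submodule.mkQ_surjective _ x
  exact ⟨Submodule.mkQ _ y, rfl⟩

/-- Lemma G -/
theorem ext_of_pow [IsNoetherianRing A] (𝔞 : Ideal A) (n : ℕ)
    (h : ∀ j ≤ n, C.mem (EX A (A ⧸ 𝔞) M j)) (j : ℕ) :
    j ≤ n → ∀ (N : Type) [AddCommGroup N] [Module A N] [Module.Finite A N] (l : ℕ),
      𝔞 ^ l ≤ Module.annihilator A N → C.mem (EX A N M j) := by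
  induction j with
  | zero =>
    intro hj
    refine C.ext_of_prime 𝔞 0 ?_
    intro p hp hap
    exact C.of_inj _ (EX.pre_inj (Submodule.factor hap : A ⧸ 𝔞 →ₗ[A] A ⧸ p) (factor_surj hap))
      (h 0 hj)
  | succ j ih =>
    intro hj
    refine C.ext_of_prime 𝔞 (j + 1) ?_
    intro p hp hap
    have hS := SES.kerOf (Submodule.factor hap : A ⧸ 𝔞 →ₗ[A] A ⧸ p) (factor_surj hap)
    refine C.mid _ _ (EX.con3 hS M j) ?_ (h _ hj)
    refine ih (by lia) _ 1 ?_
    have := LinearMap.annihilator_le_of_injective _ hS.inj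
    rw [Ideal.annihilator_quotient] at this
    simpa using this

/-- finitely generated modules -/
def fin (A : Type) [CommRing A] [IsNoetherianRing A] : SerreCl A where
  mem M _ _ := Module.Finite A M
  zero M _ _ _ := inferInstance
  mid f g h h1 h2 := by
    have h1' := isNoetherian_of_isNoetherianRing_of_finite A
    have := isNoetherian_of_range_eq_ker f g (LinearMap.exact_iff.1 h).symm
    infer_instance

/-- `S`-torsion modules -/
def tor (S : Submonoid A) : SerreCl A where
  mem M _ _ := ∀ m : M, ∃ s ∈ S, s • m = 0
  zero M _ _ _ m := ⟨1, S.one_mem, Subsingleton.elim _ _⟩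
  mid f g h h1 h2 m := by
    obtain ⟨s, hs, hm⟩ := h2 (g m)
    rw [← map_smul] at hm
    obtain ⟨y, hy⟩ := (h _).1 hm
    obtain ⟨t, ht, hy'⟩ := h1 y
    exact ⟨t * s, S.mul_mem ht hs, by rw [mul_smul, ← hy, ← map_smul, hy', map_zero]⟩

end SerreCl

/-! ### The Artin--Rees type vanishing condition -/

/-- transition maps -/
def tr (𝔞 : Ideal A) {l l' : ℕ} (h : l ≤ l') : A ⧸ 𝔞 ^ l' →ₗ[A] A ⧸ 𝔞 ^ l :=
  Submodule.factor (Ideal.pow_le_pow_right h)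

theorem tr_surj (𝔞 : Ideal A) {l l' : ℕ} (h : l ≤ l') : Function.Surjective (tr 𝔞 h) :=
  factor_surj (Ideal.pow_le_pow_right h)

theorem tr_comp (𝔞 : Ideal A) {l l' l'' : ℕ} (h : l ≤ l') (h' : l' ≤ l'') :
    tr 𝔞 h ∘ₗ tr 𝔞 h' = tr 𝔞 (h.trans h') := by
  apply LinearMap.ext
  intro x
  obtain ⟨y, rfl⟩ := Submodule.mkQ_surjective _ x
  rfl

/-- essentially zero system -/
def AR (𝔞 : Ideal A) (i : ℕ) (M : Type) [AddCommGroup M] [Module A M] : Prop :=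
  ∀ l : ℕ, ∃ (l' : ℕ) (h : l ≤ l'), ∀ x : EX A (A ⧸ 𝔞 ^ l) M i, EX.pre (tr 𝔞 h) M i x = 0

section ARsec

variable {𝔞 : Ideal A} {N N' N'' M M' M'' : Type} [AddCommGroup N] [Module A N]
  [AddCommGroup N'] [Module A N']
  [AddCommGroup N''] [Module A N''] [AddCommGroup M] [Module A M] [AddCommGroup M'] [Module A M']
  [AddCommGroup M''] [Module A M'']

theorem AR.zero (i : ℕ) [Subsingleton M] : AR 𝔞 i M :=
  fun l => ⟨l, le_rfl, fun _ => EX.eq_zero_of_subsingleton_right i _⟩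

theorem AR.mid {f : M' →ₗ[A] M} {g : M →ₗ[A] M''} (h : SES f g) {i : ℕ} (h1 : AR 𝔞 i M')
    (h2 : AR 𝔞 i M'') : AR 𝔞 i M := by
  intro l
  obtain ⟨l1, hl1, H1⟩ := h2 l
  obtain ⟨l2, hl2, H2⟩ := h1 l1
  refine ⟨l2, hl1.trans hl2, fun x => ?_⟩
  rw [← tr_comp 𝔞 hl1 hl2, EX.pre_comp]
  have : EX.post _ g i (EX.pre (tr 𝔞 hl1) M i x) = 0 := by
    rw [← EX.pre_post, H1]
  obtain ⟨y, hy⟩ := (EX.co2 h _ i _).1 this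
  rw [← hy, EX.pre_post, H2, map_zero]

theorem AR.left {f : M' →ₗ[A] M} {g : M →ₗ[A] M''} (h : SES f g) {i : ℕ} (h1 : AR 𝔞 (i + 1) M)
    (h2 : AR 𝔞 i M'') : AR 𝔞 (i + 1) M' := by
  intro l
  obtain ⟨l1, hl1, H1⟩ := h1 l
  obtain ⟨l2, hl2, H2⟩ := h2 l1
  refine ⟨l2, hl1.trans hl2, fun x => ?_⟩
  rw [← tr_comp 𝔞 hl1 hl2, EX.pre_comp]
  have : EX.post _ f (i + 1) (EX.pre (tr 𝔞 hl1) M' (i + 1) x) = 0 := by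
    rw [← EX.pre_post, H1]
  obtain ⟨y, hy⟩ := (EX.co1 h _ i _).1 this
  rw [← hy, EX.pre_dco, H2, map_zero]

theorem AR.equiv (e : M ≃ₗ[A] M') {i : ℕ} (h : AR 𝔞 i M) : AR 𝔞 i M' := by
  intro l
  obtain ⟨l', hl, H⟩ := h l
  refine ⟨l', hl, fun x => ?_⟩
  obtain ⟨y, rfl⟩ := (EX.postEquiv _ e i).surjective x
  change EX.pre _ _ _ (EX.post _ _ _ _) = 0
  rw [EX.pre_post, H, map_zero]

theorem AR.of_smul {x : A} (hx : x ∈ 𝔞) {i : ℕ}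
    (h1 : ∀ l : ℕ, AR 𝔞 (i + 1) (LinearMap.ker (LinearMap.lsmul A M (x ^ l))))
    (h2 : ∀ l : ℕ, AR 𝔞 i (M ⧸ LinearMap.range (LinearMap.lsmul A M (x ^ l)))) :
    AR 𝔞 (i + 1) M := by
  intro l
  obtain ⟨l1, hl1, H1⟩ := h2 l l
  obtain ⟨l2, hl2, H2⟩ := h1 l l1
  refine ⟨l2, hl1.trans hl2, fun ξ => ?_⟩
  set φ := LinearMap.lsmul A M (x ^ l) with hφ
  have S1 : SES (LinearMap.ker φ).subtype φ.rangeRestrict :=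
    ⟨Submodule.subtype_injective _, by
      rw [LinearMap.exact_iff, Submodule.range_subtype, LinearMap.ker_rangeRestrict],
      LinearMap.surjective_rangeRestrict φ⟩
  have S2 := SES.quot (LinearMap.range φ)
  have e : (LinearMap.range φ).subtype ∘ₗ φ.rangeRestrict = x ^ l • LinearMap.id := by
    ext m; simp [hφ]
  have k0 : EX.post _ (LinearMap.range φ).subtype (i + 1)
      (EX.post _ φ.rangeRestrict (i + 1) ξ) = 0 := by
    rw [← EX.post_comp, e, EX.post_smul_id]
    apply EX.smul_eq_zero_left
    rw [Ideal.annihilator_quotient]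
    exact Ideal.pow_mem_pow hx l
  obtain ⟨ζ, hζ⟩ := (EX.co1 S2 _ i _).1 k0
  have k1 : EX.post _ φ.rangeRestrict (i + 1) (EX.pre (tr 𝔞 hl1) M (i + 1) ξ) = 0 := by
    rw [← EX.pre_post, ← hζ, EX.pre_dco, H1, map_zero]
  obtain ⟨y, hy⟩ := (EX.co2 S1 _ _ _).1 k1
  rw [← tr_comp 𝔞 hl1 hl2, EX.pre_comp, ← hy, EX.pre_post, H2, map_zero]

theorem EX.pre_eq_zero_of_le (u : N' →ₗ[A] N) (L : Submodule A N) (h : ∀ z, u z ∈ L) (j : ℕ)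
    (x : EX A N M j) (hx : EX.pre L.subtype M j x = 0) : EX.pre u M j x = 0 := by
  have e : u = L.subtype ∘ₗ LinearMap.codRestrict L u h := by ext; rfl
  rw [e, EX.pre_comp, hx, map_zero]

theorem AR.pre_pow_smul [IsNoetherianRing A] (k : ℕ) (hk : 𝔞 ^ k ≤ Module.annihilator A M)
    (j : ℕ) : ∀ (N : Type) [AddCommGroup N] [Module A N] [Module.Finite A N],
    ∃ t : ℕ, ∀ x : EX A N M j, EX.pre (𝔞 ^ t • (⊤ : Submodule A N)).subtype M j x = 0 := by
  induction j with
  | zero =>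
    intro N _ _ _
    refine ⟨k, fun x => ?_⟩
    obtain ⟨f, rfl⟩ := EX.zeroEquiv.symm.surjective x
    rw [EX.zeroEquiv_symm_pre, LinearEquiv.map_eq_zero_iff]
    ext ⟨n, hn⟩
    simp only [LinearMap.comp_apply, Submodule.subtype_apply, LinearMap.zero_apply]
    refine Submodule.smul_induction_on hn ?_ ?_
    · intro a ha n _
      rw [map_smul]
      exact Module.mem_annihilator.1 (hk ha) _
    · intro a b ha hb
      rw [map_add, ha, hb, add_zero]
  | succ j ih =>
    intro N _ _ _
    obtain ⟨s, g, hg⟩ := exists_pres (A := A) N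
    obtain ⟨t0, ht0⟩ := ih (LinearMap.ker g)
    obtain ⟨c, hc⟩ := Ideal.exists_pow_inf_eq_pow_smul 𝔞 (LinearMap.ker g)
    refine ⟨t0 + c, fun x => ?_⟩
    obtain ⟨y, rfl⟩ := (EX.con3 hg M j x).1 (EX.proj j _)
    set t := t0 + c
    have hmem : ∀ u ∈ 𝔞 ^ t • (⊤ : Submodule A (Fin s → A)),
        g u ∈ 𝔞 ^ t • (⊤ : Submodule A N) := by
      intro u hu
      have := Submodule.mem_map_of_mem (f := g) hu
      rw [Submodule.map_smul''] at this
      exact Submodule.smul_mono le_rfl le_top this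
    let gt : (𝔞 ^ t • (⊤ : Submodule A (Fin s → A)) : Submodule A (Fin s → A)) →ₗ[A]
      (𝔞 ^ t • (⊤ : Submodule A N) : Submodule A N) := g.restrict hmem
    have gts : Function.Surjective gt := by
      rintro ⟨n, hn⟩
      have : (𝔞 ^ t • (⊤ : Submodule A N)) = (𝔞 ^ t • (⊤ : Submodule A (Fin s → A))).map g := by
        rw [Submodule.map_smul'', Submodule.map_top, LinearMap.range_eq_top.2 hg.surj]
      rw [this] at hn
      obtain ⟨u, hu, rfl⟩ := hn
      exact ⟨⟨u, hu⟩, rfl⟩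
    have S := SES.kerOf gt gts
    have hz : ∀ z : LinearMap.ker gt, (z : (𝔞 ^ t • (⊤ : Submodule A (Fin s → A)) :
        Submodule A (Fin s → A))).1 ∈ LinearMap.ker g := by
      intro z
      have := congrArg Subtype.val z.2
      exact this
    let b : LinearMap.ker gt →ₗ[A] LinearMap.ker g :=
      LinearMap.codRestrict _ (Submodule.subtype _ ∘ₗ Submodule.subtype _) hz
    have hb : ∀ z, b z ∈ 𝔞 ^ t0 • (⊤ : Submodule A (LinearMap.ker g)) := by
      intro z
      have h1 := hc t (by lia)
      have h2 : (b z : Fin s → A) ∈ 𝔞 ^ t • (⊤ : Submodule A (Fin s → A)) ⊓ LinearMap.ker g :=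
        ⟨z.1.2, (b z).2⟩
      rw [h1, show t - c = t0 by lia] at h2
      have h3 := Submodule.smul_mono (le_refl (𝔞 ^ t0)) (inf_le_right) h2
      have : 𝔞 ^ t0 • LinearMap.ker g =
          (𝔞 ^ t0 • (⊤ : Submodule A (LinearMap.ker g))).map (LinearMap.ker g).subtype := by
        rw [Submodule.map_smul'', Submodule.map_subtype_top]
      rw [this] at h3
      obtain ⟨w, hw, hw'⟩ := h3
      have : w = b z := Subtype.ext hw'
      rwa [← this]
    have key := EX.pre_eq_zero_of_le (N' := LinearMap.ker gt) b _ hb j y (ht0 y)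
    rw [← EX.dcon_nat S hg b (Submodule.subtype _) (Submodule.subtype _) (by ext; rfl)
      (by ext; rfl), key, map_zero]

theorem AR.of_pow [IsNoetherianRing A] (k : ℕ) (hk : 𝔞 ^ k ≤ Module.annihilator A M) (i : ℕ) :
    AR 𝔞 (i + 1) M := by
  intro l
  obtain ⟨t, ht⟩ := AR.pre_pow_smul k hk i (𝔞 ^ l : Ideal A)
  refine ⟨t + l, by lia, fun x => ?_⟩
  have S1 := SES.quot (𝔞 ^ l)
  have S2 := SES.quot (𝔞 ^ (t + l))
  obtain ⟨y, rfl⟩ := (EX.con3 S1 M i x).1 (EX.proj i _)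
  have hle : 𝔞 ^ (t + l) ≤ 𝔞 ^ l := Ideal.pow_le_pow_right (by lia)
  let b : (𝔞 ^ (t + l) : Ideal A) →ₗ[A] (𝔞 ^ l : Ideal A) := Submodule.inclusion hle
  have hb : ∀ z, b z ∈ 𝔞 ^ t • (⊤ : Submodule A (𝔞 ^ l : Ideal A)) := by
    intro z
    have h3 := z.2
    have : (𝔞 ^ (t + l) : Ideal A) =
        (𝔞 ^ t • (⊤ : Submodule A (𝔞 ^ l : Ideal A))).map (𝔞 ^ l : Ideal A).subtype := by
      rw [Submodule.map_smul'', Submodule.map_subtype_top, pow_add, smul_eq_mul]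
    obtain ⟨w, hw, hw'⟩ := this.le h3
    have : w = b z := Subtype.ext hw'
    rwa [← this]
  have key := EX.pre_eq_zero_of_le b _ hb i y (ht y)
  rw [← EX.dcon_nat S2 S1 b LinearMap.id (tr 𝔞 (by lia)) (by ext; rfl)
      (by ext; rfl), key, map_zero]

/-- Lemma F -/
theorem AR.mem [IsNoetherianRing A] (C : SerreCl A) {i : ℕ} (h : AR 𝔞 (i + 1) M)
    (hj : ∀ j ≤ i, C.mem (EX A (A ⧸ 𝔞) M j)) : C.mem (EX A (A ⧸ 𝔞) M (i + 1)) := by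
  obtain ⟨l', hl, H⟩ := h 1
  have S := SES.kerOf (tr 𝔞 hl) (tr_surj 𝔞 hl)
  have k1 : C.mem (EX A (LinearMap.ker (tr 𝔞 hl)) M i) := by
    refine C.ext_of_pow 𝔞 i hj i le_rfl _ l' ?_
    have := LinearMap.annihilator_le_of_injective _ S.inj
    rwa [Ideal.annihilator_quotient] at this
  have k2 : C.mem (EX A (A ⧸ 𝔞 ^ 1) M (i + 1)) :=
    C.of_surj (EX.dcon S M i) (fun x => (EX.con3 S M i x).1 (H x)) k1
  refine C.of_equiv (EX.preEquiv (Submodule.quotEquivOfEq _ _ ?_) M (i + 1)) k2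
  simp

theorem AR.mem_all [IsNoetherianRing A] (C : SerreCl A) (n : ℕ) (h : ∀ i, n ≤ i → AR 𝔞 (i + 1) M)
    (hj : ∀ j ≤ n, C.mem (EX A (A ⧸ 𝔞) M j)) (j : ℕ) : C.mem (EX A (A ⧸ 𝔞) M j) := by
  induction j using Nat.strong_induction_on with
  | _ j ih =>
    by_cases hjn : j ≤ n
    · exact hj j hjn
    · obtain ⟨i, rfl⟩ : ∃ i, j = i + 1 := ⟨j - 1, by lia⟩
      exact (h i (by lia)).mem C fun j hj => ih j (by lia)

end ARsec

/-! ### Classes of modules that become noetherian or artinian after localization -/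

namespace SerreCl

/-- modules whose localization at `S` is finitely generated -/
def noe (A : Type) [CommRing A] [IsNoetherianRing A] (S : Submonoid A) : SerreCl A where
  mem M _ _ := ∃ F : Submodule A M, F.FG ∧ ∀ m : M, ∃ s ∈ S, s • m ∈ F
  zero M _ _ _ := ⟨⊥, Submodule.fg_bot, fun m => ⟨1, S.one_mem, Subsingleton.elim (α := M) _ _⟩⟩
  mid {M' M M''} _ _ _ _ _ _ f g h h1 h2 := by
    classical
    obtain ⟨F', hF', H'⟩ := h1
    obtain ⟨F'', hF'', H''⟩ := h2
    have : IsNoetherian A F'' := isNoetherian_of_fg_of_noetherian _ hF''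
    have hfg : ((F''.comap g).map g).FG := by
      have hle : (F''.comap g).map g ≤ F'' := Submodule.map_comap_le _ _
      exact Submodule.FG.of_le hF'' hle
    obtain ⟨T, hT⟩ := hfg
    have hT' : (T : Set M'') ⊆ g '' (F''.comap g : Set M) := by
      intro t ht
      have := hT ▸ Submodule.subset_span ht
      exact this
    obtain ⟨T1, hT1, rfl⟩ := Finset.subset_set_image_iff.1 hT'
    refine ⟨F'.map f ⊔ Submodule.span A T1, (hF'.map f).sup ⟨T1, rfl⟩, fun m => ?_⟩
    obtain ⟨s, hs, hm⟩ := H'' (g m)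
    have k1 : g (s • m) ∈ Submodule.map g (Submodule.span A (T1 : Set M)) := by
      rw [Submodule.map_span]
      rw [Finset.coe_image] at hT
      rw [hT]
      exact ⟨s • m, by simpa using hm, rfl⟩
    obtain ⟨u, hu, hgu⟩ := k1
    obtain ⟨v, hv⟩ := (h (s • m - u)).1 (by rw [map_sub, hgu, sub_self])
    obtain ⟨s', hs', hv'⟩ := H' v
    refine ⟨s' * s, S.mul_mem hs' hs, ?_⟩
    have : (s' * s) • m = f (s' • v) + s' • u := by
      rw [map_smul, hv, smul_sub, smul_smul]; abel
    rw [this]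
    exact Submodule.add_mem_sup (Submodule.mem_map_of_mem hv') (Submodule.smul_mem _ _ hu)

/-- modules whose localization at `S` is artinian -/
def art (A : Type) [CommRing A] (S : Submonoid A) : SerreCl A where
  mem M _ _ := ∀ L : ℕ → Submodule A M, Antitone L →
    ∃ n, ∀ k, n ≤ k → ∀ x ∈ L n, ∃ s ∈ S, s • x ∈ L k
  zero M _ _ _ L _ := ⟨0, fun k _ x _ => ⟨1, S.one_mem, by
    rw [Subsingleton.elim (α := M) (1 • x) 0]; exact Submodule.zero_mem _⟩⟩
  mid {M' M M''} _ _ _ _ _ _ f g h h1 h2 := by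
    intro L hL
    obtain ⟨n1, H1⟩ := h1 (fun n => (L n).comap f) (fun a b hab => Submodule.comap_mono (hL hab))
    obtain ⟨n2, H2⟩ := h2 (fun n => (L n).map g) (fun a b hab => Submodule.map_mono (hL hab))
    have key : ∀ n, n1 ≤ n → ∀ k, n ≤ k → ∀ x ∈ (L n).comap f, ∃ s ∈ S, s • x ∈ (L k).comap f :=
      fun n hn k hk x hx => H1 k (hn.trans hk) x (Submodule.comap_mono (hL hn) hx)
    refine ⟨max n1 n2, fun k hk x hx => ?_⟩
    obtain ⟨s, hs, y, hy, hxy⟩ := H2 k ((le_max_right _ _).trans hk) (g x)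
      (Submodule.mem_map_of_mem (hL (le_max_right _ _) hx))
    obtain ⟨u, hu⟩ := (h (s • x - y)).1 (by rw [map_sub, hxy, map_smul, sub_self])
    obtain ⟨s', hs', hu'⟩ := key _ (le_max_left n1 n2) k hk u (by
      rw [Submodule.mem_comap, hu]
      exact Submodule.sub_mem _ (Submodule.smul_mem _ _ hx) (hL hk hy))
    refine ⟨s' * s, S.mul_mem hs' hs, ?_⟩
    have : (s' * s) • x = f (s' • u) + s' • y := by
      rw [map_smul, hu, smul_sub, smul_smul]; abel
    rw [this]
    exact Submodule.add_mem _ hu' (Submodule.smul_mem _ _ hy)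

section

variable {S S' : Submonoid A} {M N : Type} [AddCommGroup M] [Module A M] [AddCommGroup N] [Module A N]

theorem noe_of_finite [IsNoetherianRing A] (S : Submonoid A) (h : Module.Finite A M) :
    (noe A S).mem M := ⟨⊤, h.1, fun m => ⟨1, S.one_mem, trivial⟩⟩

theorem noe_of_tor [IsNoetherianRing A] (h : (tor S).mem M) : (noe A S).mem M :=
  ⟨⊥, Submodule.fg_bot, fun m => by simpa using h m⟩

theorem art_of_tor (h : (tor S).mem M) : (art A S).mem M := by
  intro L _
  refine ⟨0, fun k _ x _ => ?_⟩
  obtain ⟨s, hs, hx⟩ := h x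
  exact ⟨s, hs, hx ▸ Submodule.zero_mem _⟩

theorem noe_mono [IsNoetherianRing A] (hS : S ≤ S') (h : (noe A S).mem M) : (noe A S').mem M := by
  obtain ⟨F, hF, H⟩ := h
  refine ⟨F, hF, fun m => ?_⟩
  obtain ⟨s, hs, hm⟩ := H m
  exact ⟨s, hS hs, hm⟩

theorem noe_bot [IsNoetherianRing A] : (noe A (⊥ : Submonoid A)).mem M ↔ Module.Finite A M := by
  constructor
  · rintro ⟨F, hF, H⟩
    have : F = ⊤ := by
      rw [eq_top_iff]
      intro x _
      obtain ⟨s, hs, hx⟩ := H x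
      rw [Submonoid.mem_bot] at hs
      simpa [hs] using hx
    exact ⟨this ▸ hF⟩
  · exact noe_of_finite _

/-- `M` noetherian at `S` contains a f.g. submodule with torsion quotient -/
theorem noe_quot [IsNoetherianRing A] (h : (noe A S).mem M) : ∃ F : Submodule A M, F.FG ∧
    (tor S).mem (M ⧸ F) := by
  obtain ⟨F, hF, H⟩ := h
  refine ⟨F, hF, fun m => ?_⟩
  obtain ⟨m, rfl⟩ := F.mkQ_surjective m
  obtain ⟨s, hs, hm⟩ := H m
  exact ⟨s, hs, by rw [← map_smul]; exact (Submodule.Quotient.mk_eq_zero F).2 hm⟩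

/-- the condition `V(𝔟)` has dimension zero away from `S`. -/
def _root_.HCond (S : Submonoid A) (𝔟 : Ideal A) : Prop :=
  ∀ p q : Ideal A, p.IsPrime → q.IsPrime → 𝔟 ≤ p → p ≤ q → (∀ s ∈ S, s ∉ q) → p = q

theorem _root_.HCond.exists_mem {𝔟 : Ideal A} (h : HCond S 𝔟) {p I : Ideal A} [hp : p.IsPrime]
    (hb : 𝔟 ≤ p) (hI : p < I) : ∃ s ∈ S, s ∈ I := by
  by_contra! hc
  obtain ⟨q, hq, hIq, hd⟩ := Ideal.exists_le_prime_disjoint I S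
    (Set.disjoint_left.2 fun a ha ha' => hc a ha' ha)
  have := h p q hp hq hb (hI.le.trans hIq) (fun s hs hsq => Set.disjoint_left.1 hd hsq hs)
  exact absurd (this ▸ hIq) hI.not_ge

theorem H_prime {𝔟 : Ideal A} (h : HCond S 𝔟) {p : Ideal A} [hp : p.IsPrime]
    (hb : 𝔟 ≤ p) : (art A S).mem (A ⧸ p) := by
  intro L hL
  by_cases hc : ∃ n, L n = ⊥
  · obtain ⟨n, hn⟩ := hc
    refine ⟨n, fun k _ x hx => ⟨1, S.one_mem, ?_⟩⟩
    rw [hn, Submodule.mem_bot] at hx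
    simp [hx]
  · push Not at hc
    refine ⟨0, fun k _ x _ => ?_⟩
    obtain ⟨s, hs, hsI⟩ := h.exists_mem (p := p) (I := (L k).comap p.mkQ) hb (by
      refine lt_of_le_of_ne ?_ ?_
      · intro a ha
        have : p.mkQ a = 0 := by simpa [Ideal.Quotient.eq_zero_iff_mem] using ha
        rw [Submodule.mem_comap, this]
        exact Submodule.zero_mem _
      · intro e
        apply hc k
        rw [← Submodule.map_comap_eq_self (f := p.mkQ) (q := L k) (by
          rw [LinearMap.range_eq_top.2 p.mkQ_surjective]; exact le_top), ← e]
        exact Submodule.mkQ_map_self p)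
    refine ⟨s, hs, ?_⟩
    obtain ⟨a, rfl⟩ := p.mkQ_surjective x
    have := Submodule.smul_mem _ a (show p.mkQ s ∈ L k from hsI)
    rwa [← map_smul, smul_eq_mul, mul_comm, ← smul_eq_mul, map_smul] at this

theorem art_of_noe_of_finite [IsNoetherianRing A] {𝔟 : Ideal A} (h : HCond S 𝔟)
    (hM : 𝔟 ≤ Module.annihilator A M) [hf : Module.Finite A M] : (art A S).mem M := by
  induction hf using IsNoetherianRing.induction_on_isQuotientEquivQuotientPrime A with
  | subsingleton N => exact (art A S).zero _
  | quotient N p e =>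
    refine (art A S).of_equiv e.symm (H_prime h ?_)
    rw [e.annihilator_eq, Ideal.annihilator_quotient] at hM
    exact hM
  | exact N1 N2 N3 f g hf hg hex h1 h2 =>
    exact (art A S).mid f g hex (h1 (hM.trans (f.annihilator_le_of_injective hf)))
      (h2 (hM.trans (g.annihilator_le_of_surjective hg)))

theorem annihilator_sub (L : Submodule A M) : Module.annihilator A M ≤ Module.annihilator A L :=
  LinearMap.annihilator_le_of_injective L.subtype L.subtype_injective

theorem annihilator_quot (L : Submodule A M) :
    Module.annihilator A M ≤ Module.annihilator A (M ⧸ L) :=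
  LinearMap.annihilator_le_of_surjective L.mkQ L.mkQ_surjective

/-- Lemma H -/
theorem art_of_noe [IsNoetherianRing A] {𝔟 : Ideal A} (h : HCond S 𝔟)
    (hM : 𝔟 ≤ Module.annihilator A M) (hn : (noe A S).mem M) : (art A S).mem M := by
  obtain ⟨F, hF, ht⟩ := noe_quot hn
  have : Module.Finite A F := Module.Finite.of_fg hF
  exact (art A S).mid F.subtype F.mkQ (LinearMap.exact_subtype_mkQ F)
    (art_of_noe_of_finite h (hM.trans (annihilator_sub F))) (art_of_tor ht)

end

end SerreCl

namespace SerreCl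

section

variable {S S' : Submonoid A} {M N : Type} [AddCommGroup M] [Module A M] [AddCommGroup N] [Module A N]

/-- saturation of a submodule -/
def _root_.satS (S : Submonoid A) (F : Submodule A M) : Submodule A M where
  carrier := {x | ∃ s ∈ S, s • x ∈ F}
  zero_mem' := ⟨1, S.one_mem, by simp⟩
  add_mem' := by
    rintro x y ⟨s, hs, hx⟩ ⟨t, ht, hy⟩
    refine ⟨s * t, S.mul_mem hs ht, ?_⟩
    rw [smul_add]
    refine Submodule.add_mem _ ?_ ?_
    · rw [mul_comm, mul_smul]; exact Submodule.smul_mem _ _ hx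
    · rw [mul_smul]; exact Submodule.smul_mem _ _ hy
  smul_mem' := by
    rintro c x ⟨s, hs, hx⟩
    exact ⟨s, hs, by rw [smul_comm]; exact Submodule.smul_mem _ _ hx⟩

theorem _root_.mem_satS {F : Submodule A M} {x : M} : x ∈ satS S F ↔ ∃ s ∈ S, s • x ∈ F := Iff.rfl

theorem _root_.le_satS {F : Submodule A M} : F ≤ satS S F := fun x hx => ⟨1, S.one_mem, by simpa⟩

theorem _root_.satS_mono {F G : Submodule A M} (h : F ≤ G) : satS S F ≤ satS S G :=
  fun x ⟨s, hs, hx⟩ => ⟨s, hs, h hx⟩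

theorem _root_.satS_satS {F : Submodule A M} : satS S (satS S F) = satS S F := by
  refine le_antisymm ?_ le_satS
  rintro x ⟨s, hs, t, ht, hx⟩
  exact ⟨t * s, S.mul_mem ht hs, by rwa [mul_smul]⟩

/-- Finiteness lemma, prime case -/
theorem noe_of_art_prime [IsNoetherianRing A] {𝔟 : Ideal A} (h : HCond S 𝔟)
    {p : Ideal A} [hp : p.IsPrime] (hb : 𝔟 ≤ p)
    (hM : p ≤ Module.annihilator A M) (ha : (art A S).mem M) : (noe A S).mem M := by
  classical
  by_contra hc
  have hc' : ∀ F : Submodule A M, F.FG → ∃ m, m ∉ satS S F := by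
    intro F hF
    by_contra! hall
    exact hc ⟨F, hF, hall⟩
  choose! pick hpick using hc'
  -- build sequence
  let G : ℕ → Submodule A M := fun n => Nat.rec ⊥ (fun _ F => F ⊔ Submodule.span A {pick F}) n
  have hG : ∀ n, (G n).FG := by
    intro n
    induction n with
    | zero => exact Submodule.fg_bot
    | succ n ih => exact ih.sup (Submodule.fg_span_singleton _)
  let x : ℕ → M := fun n => pick (G n)
  have hx : ∀ n, x n ∉ satS S (G n) := fun n => hpick _ (hG n)
  have hGs : ∀ n, G (n + 1) = G n ⊔ Submodule.span A {x n} := fun n => rfl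
  have hGm : Monotone G := monotone_nat_of_le_succ fun n => by rw [hGs]; exact le_sup_left
  have hxG : ∀ n k, n < k → x n ∈ G k := fun n k hnk => hGm hnk (by
    rw [hGs]; exact Submodule.mem_sup_right (Submodule.mem_span_singleton_self _))
  have hxG' : ∀ n, G n = Submodule.span A (x '' Set.Iio n) := by
    intro n
    refine le_antisymm ?_ ?_
    · induction n with
      | zero => exact bot_le
      | succ n ih =>
        rw [hGs]
        refine sup_le (ih.trans (Submodule.span_mono (Set.image_mono (fun a ha => ?_)))) ?_
        · exact Set.mem_Iio.2 (lt_trans ha (Nat.lt_succ_self n))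
        · rw [Submodule.span_singleton_le_iff_mem]
          exact Submodule.subset_span ⟨n, Nat.lt_succ_self n, rfl⟩
    · rw [Submodule.span_le]
      rintro _ ⟨k, hk, rfl⟩
      exact hxG k n hk
  -- tails
  let T : ℕ → Submodule A M := fun n => Submodule.span A (x '' Set.Ici n)
  obtain ⟨n, hn⟩ := ha T (fun a b hab => Submodule.span_mono (Set.image_mono (Set.Ici_subset_Ici.2 hab)))
  obtain ⟨s, hs, hsx⟩ := hn (n + 1) (by lia) (x n) (Submodule.subset_span ⟨n, Set.self_mem_Ici, rfl⟩)
  -- unit trick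
  have hunit : ∀ a : A, a ∉ p → ∃ b : A, ∃ s ∈ S, ∀ m : M, (b * a) • m = s • m := by
    intro a ha
    obtain ⟨s, hs, hsI⟩ := h.exists_mem (p := p) (I := p ⊔ Ideal.span {a}) hb (by
      refine lt_of_le_of_ne le_sup_left fun e => ha ?_
      rw [e]; exact Ideal.mem_sup_right (Ideal.mem_span_singleton_self a))
    obtain ⟨c, hc, d, hd, rfl⟩ := Submodule.mem_sup.1 hsI
    obtain ⟨b, rfl⟩ := Ideal.mem_span_singleton'.1 hd
    refine ⟨b, _, hs, fun m => ?_⟩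
    rw [add_smul, Module.mem_annihilator.1 (hM hc) m, zero_add]
  have key : ∀ k, n < k → ∀ y ∈ Submodule.span A (x '' Set.Ico (n + 1) k), ∀ s ∈ S,
      s • x n ≠ y := by
    intro k hk
    induction k, hk using Nat.le_induction with
    | base =>
      intro y hy s hs e
      simp only [Nat.succ_eq_add_one, Set.Ico_self, Set.image_empty, Submodule.span_empty,
        Submodule.mem_bot] at hy
      exact hx n ⟨s, hs, by rw [e, hy]; exact Submodule.zero_mem _⟩
    | succ k hk ih =>
      intro y hy s hs e
      have hset : Set.Ico (n + 1) (k + 1) = insert k (Set.Ico (n + 1) k) := by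
        ext a; simp; lia
      rw [hset, Set.image_insert_eq, Submodule.mem_span_insert] at hy
      obtain ⟨a, z, hz, rfl⟩ := hy
      by_cases hap : a ∈ p
      · refine ih z hz s hs ?_
        rw [e, Module.mem_annihilator.1 (hM hap), zero_add]
      · obtain ⟨b, t, ht, hbt⟩ := hunit a hap
        apply hx k
        refine ⟨t, ht, ?_⟩
        rw [← hbt, mul_smul]
        refine Submodule.smul_mem _ _ ?_
        have : a • x k = s • x n - z := by rw [e]; abel
        rw [this]
        refine Submodule.sub_mem _ (Submodule.smul_mem _ _ (hxG n k hk)) ?_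
        refine (Submodule.span_le.2 ?_ : Submodule.span A _ ≤ G k) hz
        rintro _ ⟨j, hj, rfl⟩
        exact hxG j k hj.2
  obtain ⟨k, hk, hsk⟩ : ∃ k, n < k ∧ s • x n ∈ Submodule.span A (x '' Set.Ico (n + 1) k) := by
    have hU : (x '' Set.Ici (n + 1)) = ⋃ k : ℕ, x '' Set.Ico (n + 1) k := by
      rw [← Set.image_iUnion]
      congr 1
      ext a
      simp only [Set.mem_Ici, Set.mem_iUnion, Set.mem_Ico]
      exact ⟨fun h => ⟨a + 1, h, by lia⟩, fun ⟨_, h, _⟩ => h⟩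
    change s • x n ∈ Submodule.span A (x '' Set.Ici (n + 1)) at hsx
    rw [hU, Submodule.span_iUnion, Submodule.mem_iSup_of_directed] at hsx
    · obtain ⟨k, hk⟩ := hsx
      refine ⟨max k (n + 1), by lia, Submodule.span_mono (Set.image_mono ?_) hk⟩
      exact Set.Ico_subset_Ico_right (le_max_left _ _)
    · apply Monotone.directed_le
      intro a b hab
      exact Submodule.span_mono (Set.image_mono (Set.Ico_subset_Ico_right hab))
  exact key k hk _ hsk s hs rfl

/-- Finiteness lemma -/
theorem noe_of_art [IsNoetherianRing A] {𝔟 : Ideal A} (h : HCond S 𝔟)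
    (hM : 𝔟 ≤ Module.annihilator A M) (ha : (art A S).mem M) : (noe A S).mem M := by
  have main : ∀ 𝔠 : Ideal A, 𝔟 ≤ 𝔠 → ∀ (M : Type) [AddCommGroup M] [Module A M],
      𝔠 ≤ Module.annihilator A M → (art A S).mem M → (noe A S).mem M := by
    intro 𝔠
    induction 𝔠 using WellFoundedGT.induction with
    | _ 𝔠 ih =>
    intro hc M _ _ hM ha
    by_cases hp : 𝔠.IsPrime
    · exact noe_of_art_prime h hc hM ha
    rw [Ideal.isPrime_iff] at hp
    push Not at hp
    by_cases ht : 𝔠 = ⊤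
    · have : Subsingleton M := by
        rw [← Module.annihilator_eq_top_iff (R := A), eq_top_iff, ← ht]; exact hM
      exact (noe A S).zero _
    obtain ⟨a, b, hab, ha', hb'⟩ := hp ht
    have hlt : ∀ r : A, r ∉ 𝔠 → 𝔠 < 𝔠 ⊔ Ideal.span {r} := fun r hr =>
      lt_of_le_of_ne le_sup_left fun e => hr (by
        rw [e]; exact Ideal.mem_sup_right (Ideal.mem_span_singleton_self r))
    set φ := LinearMap.lsmul A M a
    refine (noe A S).mid (LinearMap.range φ).subtype (LinearMap.range φ).mkQ
      (LinearMap.exact_subtype_mkQ _) ?_ ?_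
    · refine ih _ (hlt b hb') (hc.trans le_sup_left) _ ?_ ((art A S).of_sub _ ha)
      refine sup_le (hM.trans (annihilator_sub _)) ?_
      rw [Ideal.span_singleton_le_iff_mem, Module.mem_annihilator]
      rintro ⟨_, m, rfl⟩
      apply Subtype.ext
      change b • a • m = 0
      rw [smul_smul, mul_comm]
      exact Module.mem_annihilator.1 (hM hab) m
    · refine ih _ (hlt a ha') (hc.trans le_sup_left) _ ?_ ((art A S).of_quot _ ha)
      refine sup_le (hM.trans (annihilator_quot _)) ?_
      rw [Ideal.span_singleton_le_iff_mem, Module.mem_annihilator]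
      intro m
      obtain ⟨m, rfl⟩ := Submodule.mkQ_surjective _ m
      rw [← map_smul]
      exact (Submodule.Quotient.mk_eq_zero _).2 ⟨m, rfl⟩
  exact main 𝔟 le_rfl M hM ha

/-- `𝔟`-torsion modules -/
def _root_.ITor (𝔟 : Ideal A) (M : Type) [AddCommGroup M] [Module A M] : Prop :=
  ∀ m : M, ∃ n : ℕ, ∀ a ∈ 𝔟 ^ n, a • m = 0

/-- elements killed by `𝔟` -/
def _root_.tsub (𝔟 : Ideal A) (M : Type) [AddCommGroup M] [Module A M] : Submodule A M where
  carrier := {m | ∀ a ∈ 𝔟, a • m = 0}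
  zero_mem' := by simp
  add_mem' := by
    intro x y hx hy a ha
    rw [smul_add, hx a ha, hy a ha, add_zero]
  smul_mem' := by
    intro c x hx a ha
    rw [smul_comm, hx a ha, smul_zero]

theorem _root_.mem_tsub {𝔟 : Ideal A} {m : M} : m ∈ tsub 𝔟 M ↔ ∀ a ∈ 𝔟, a • m = 0 := Iff.rfl

theorem _root_.ITor.of_inj {𝔟 : Ideal A} (f : N →ₗ[A] M) (hf : Function.Injective f)
    (h : ITor 𝔟 M) : ITor 𝔟 N := by
  intro m
  obtain ⟨n, hn⟩ := h (f m)
  refine ⟨n, fun a ha => hf ?_⟩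
  rw [map_smul, hn a ha, map_zero]

theorem _root_.ITor.of_surj {𝔟 : Ideal A} (f : M →ₗ[A] N) (hf : Function.Surjective f)
    (h : ITor 𝔟 M) : ITor 𝔟 N := by
  intro m
  obtain ⟨m, rfl⟩ := hf m
  obtain ⟨n, hn⟩ := h m
  refine ⟨n, fun a ha => ?_⟩
  rw [← map_smul, hn a ha, map_zero]

theorem _root_.ITor.mono {𝔟 𝔠 : Ideal A} (h : ITor 𝔟 M) (hc : 𝔠 ≤ 𝔟) : ITor 𝔠 M := by
  intro m
  obtain ⟨n, hn⟩ := h m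
  exact ⟨n, fun a ha => hn a (Ideal.pow_right_mono hc n ha)⟩

/-- Artinian criterion, one element -/
theorem art_of_ker {x : A} (hx : ∀ m : M, ∃ n : ℕ, x ^ n • m = 0)
    (h : (art A S).mem (LinearMap.ker (LinearMap.lsmul A M x))) : (art A S).mem M := by
  intro L hL
  set E := LinearMap.ker (LinearMap.lsmul A M x) with hE
  have hmE : ∀ u : M, u ∈ E ↔ x • u = 0 := fun u => Iff.rfl
  -- K k n
  let K : ℕ → ℕ → Submodule A E := fun k n =>
    ((L n).map (LinearMap.lsmul A M (x ^ k))).comap E.subtype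
  have hKmem : ∀ k n (u : E), u ∈ K k n ↔ ∃ y ∈ L n, x ^ k • y = u := fun k n u => Iff.rfl
  have hKn : ∀ k n n', n ≤ n' → K k n' ≤ K k n := by
    intro k n n' hn u hu
    obtain ⟨y, hy, e⟩ := hu
    exact ⟨y, hL hn hy, e⟩
  have hKk : ∀ n k k', k ≤ k' → K k' n ≤ K k n := by
    intro n k k' hk u hu
    rw [hKmem] at hu ⊢
    obtain ⟨y, hy, e⟩ := hu
    refine ⟨x ^ (k' - k) • y, Submodule.smul_mem _ _ hy, ?_⟩
    rw [smul_smul, ← pow_add, ← e]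
    congr 2; lia
  obtain ⟨n0, h0⟩ := h (fun n => K n n) (fun a b hab => (hKn b a b hab).trans (hKk a a b hab))
  choose nk hnk using fun k => h (fun n => K k n) (fun a b hab => hKn k a b hab)
  obtain ⟨N, hN0, hNk⟩ : ∃ N, n0 ≤ N ∧ ∀ k < n0, nk k ≤ N := by
    refine ⟨max n0 ((Finset.range n0).sup nk), le_max_left _ _, fun k hk => ?_⟩
    exact (Finset.le_sup (f := nk) (Finset.mem_range.2 hk)).trans (le_max_right _ _)
  have main : ∀ k m, N ≤ m → ∀ u ∈ K k N, ∃ s ∈ S, s • u ∈ K k m := by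
    intro k m hm u hu
    by_cases hk : k < n0
    · exact hnk k m ((hNk k hk).trans hm) u (hKn k _ _ (hNk k hk) hu)
    · obtain ⟨s, hs, hsu⟩ := h0 (max k m) (by lia) u (hKk _ n0 k (by lia) (hKn k _ _ hN0 hu))
      exact ⟨s, hs, hKk _ _ _ (le_max_left k m) (hKn _ _ _ (le_max_right k m) hsu)⟩
  refine ⟨N, fun m hm => ?_⟩
  have key : ∀ k, ∀ y ∈ L N, x ^ k • y = 0 → ∃ s ∈ S, s • y ∈ L m := by
    intro k
    induction k with
    | zero =>
      intro y _ hy0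
      refine ⟨1, S.one_mem, ?_⟩
      rw [pow_zero] at hy0
      rw [hy0]; exact Submodule.zero_mem _
    | succ k ih =>
      intro y hy hy0
      obtain ⟨s, hs, hsu⟩ := main k m hm ⟨x ^ k • y, by
        rw [hmE, smul_smul, ← pow_succ', hy0]⟩ ⟨y, hy, rfl⟩
      rw [hKmem] at hsu
      obtain ⟨y', hy', e⟩ := hsu
      change x ^ k • y' = s • x ^ k • y at e
      obtain ⟨t, ht, hty⟩ := ih (s • y - y') (Submodule.sub_mem _ (Submodule.smul_mem _ _ hy)
        (hL hm hy')) (by rw [smul_sub, e, smul_comm, sub_self])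
      refine ⟨t * s, S.mul_mem ht hs, ?_⟩
      have : (t * s) • y = t • (s • y - y') + t • y' := by rw [smul_sub, smul_smul]; abel
      rw [this]
      exact Submodule.add_mem _ hty (Submodule.smul_mem _ _ hy')
  intro y hy
  obtain ⟨k, hk⟩ := hx y
  exact key k y hy hk

/-- Artinian criterion -/
theorem art_of_tsub [IsNoetherianRing A] (𝔟 : Ideal A) (hx : ITor 𝔟 M)
    (h : (art A S).mem (tsub 𝔟 M)) : (art A S).mem M := by
  have main : ∀ 𝔟 : Ideal A, ∀ (M : Type) [AddCommGroup M] [Module A M], ITor 𝔟 M →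
      (art A S).mem (tsub 𝔟 M) → (art A S).mem M := by
    intro 𝔟
    induction 𝔟, 𝔟.fg_of_isNoetherianRing using Submodule.fg_induction with
    | singleton x =>
      intro M _ _ hx h
      refine art_of_ker (x := x) ?_ ?_
      · intro m
        obtain ⟨n, hn⟩ := hx m
        exact ⟨n, hn _ (Ideal.pow_mem_pow (Ideal.mem_span_singleton_self x) n)⟩
      · refine (art A S).of_inj (Submodule.inclusion ?_) (Submodule.inclusion_injective _) h
        intro m hm a ha
        obtain ⟨c, rfl⟩ := Submodule.mem_span_singleton.1 ha
        change x • m = 0 at hm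
        rw [smul_assoc, hm, smul_zero]
    | sup 𝔟 𝔠 _ _ h1 h2 =>
      intro M _ _ hx h
      refine h1 M (hx.mono le_sup_left) (h2 _ ?_ ?_)
      · exact (hx.mono le_sup_right).of_inj (Submodule.subtype _) (Submodule.subtype_injective _)
      · let f : tsub 𝔠 (tsub 𝔟 M) →ₗ[A] tsub (𝔟 ⊔ 𝔠) M := LinearMap.codRestrict _
          (Submodule.subtype _ ∘ₗ Submodule.subtype _) (by
            intro m a ha
            obtain ⟨b, hb, c, hc, rfl⟩ := Submodule.mem_sup.1 ha
            rw [add_smul]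
            have e1 : b • m.1.1 = 0 := m.1.2 b hb
            have e2 : c • m.1.1 = 0 := congrArg Subtype.val (m.2 c hc)
            simp [e1, e2])
        refine (art A S).of_inj f ?_ h
        intro a b hab
        have := congrArg Subtype.val hab
        exact Subtype.ext (Subtype.ext this)
  exact main 𝔟 M hx h

/-- `Hom(A/𝔟, M)` is the submodule of elements killed by `𝔟` -/
def _root_.EX.tsubEquiv (𝔟 : Ideal A) (M : Type) [AddCommGroup M] [Module A M] :
    EX A (A ⧸ 𝔟) M 0 ≃ₗ[A] tsub 𝔟 M :=
  EX.zeroEquiv.trans (LinearEquiv.ofBijective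
    (LinearMap.codRestrict (tsub 𝔟 M) (LinearMap.applyₗ (𝔟.mkQ 1)) (by
      intro f a ha
      have : 𝔟.mkQ a = 0 := (Submodule.Quotient.mk_eq_zero _).2 ha
      rw [LinearMap.applyₗ_apply_apply, ← map_smul, ← map_smul, smul_eq_mul, mul_one, this,
        map_zero]))
    ⟨by
      rw [← LinearMap.ker_eq_bot, LinearMap.ker_eq_bot']
      intro f hf
      have hf1 : f (𝔟.mkQ 1) = 0 := congrArg Subtype.val hf
      ext
      exact hf1, by
      rintro ⟨m, hm⟩
      have hle : 𝔟 ≤ LinearMap.ker (LinearMap.toSpanSingleton A M m) := fun a ha => hm a ha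
      refine ⟨Submodule.liftQ 𝔟 (LinearMap.toSpanSingleton A M m) hle, ?_⟩
      apply Subtype.ext
      change Submodule.liftQ 𝔟 (LinearMap.toSpanSingleton A M m) hle (𝔟.mkQ 1) = m
      rw [Submodule.mkQ_apply, Submodule.liftQ_apply]
      simp⟩)

end

end SerreCl

/-- elements of `S` act bijectively -/
def SInv (S : Submonoid A) (M : Type) [AddCommGroup M] [Module A M] : Prop :=
  ∀ s ∈ S, Function.Bijective fun m : M => s • m

section SInvSec

open SerreCl

variable {S : Submonoid A} {M N : Type} [AddCommGroup M] [Module A M] [AddCommGroup N] [Module A N]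

theorem SInv.bot (M : Type) [AddCommGroup M] [Module A M] : SInv (⊥ : Submonoid A) M := by
  intro s hs
  rw [Submonoid.mem_bot] at hs
  subst hs
  simp only [one_smul]
  exact Function.bijective_id

theorem SInv.sub (h : SInv S M) (L : Submodule A M) (hL : satS S L ≤ L) : SInv S L := by
  intro s hs
  constructor
  · intro a b hab
    exact Subtype.ext ((h s hs).1 (congrArg Subtype.val hab))
  · rintro ⟨l, hl⟩
    obtain ⟨m, hm⟩ := (h s hs).2 l
    change s • m = l at hm
    exact ⟨⟨m, hL ⟨s, hs, hm ▸ hl⟩⟩, Subtype.ext hm⟩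

theorem SInv.quot (h : SInv S M) (L : Submodule A M) (hL : satS S L ≤ L) : SInv S (M ⧸ L) := by
  intro s hs
  constructor
  · intro a b hab
    obtain ⟨a, rfl⟩ := L.mkQ_surjective a
    obtain ⟨b, rfl⟩ := L.mkQ_surjective b
    change s • L.mkQ a = s • L.mkQ b at hab
    rw [← sub_eq_zero, ← map_smul, ← map_smul, ← map_sub, ← smul_sub] at hab
    have h2 : s • (a - b) ∈ L := (Submodule.Quotient.mk_eq_zero _).1 hab
    have h3 : a - b ∈ L := hL ⟨s, hs, h2⟩
    rw [← sub_eq_zero, ← map_sub]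
    exact (Submodule.Quotient.mk_eq_zero _).2 h3
  · intro a
    obtain ⟨a, rfl⟩ := L.mkQ_surjective a
    obtain ⟨m, hm⟩ := (h s hs).2 a
    refine ⟨L.mkQ m, ?_⟩
    change s • L.mkQ m = _
    rw [← map_smul]
    exact congrArg _ hm

theorem SInv.sat_ker (h : SInv S N) (f : M →ₗ[A] N) : satS S (LinearMap.ker f) ≤ LinearMap.ker f := by
  rintro m ⟨s, hs, hm⟩
  rw [LinearMap.mem_ker, map_smul] at hm
  apply (h s hs).1
  simpa using hm

theorem SInv.sat_range (h : SInv S M) (h' : SInv S N) (f : M →ₗ[A] N) :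
    satS S (LinearMap.range f) ≤ LinearMap.range f := by
  rintro n ⟨s, hs, m, hm⟩
  obtain ⟨m', rfl⟩ := (h s hs).2 m
  refine ⟨m', (h' s hs).1 ?_⟩
  simpa using hm

theorem exists_pow_le_ann [IsNoetherianRing A] {𝔞 𝔠 : Ideal A} (h : ∀ x ∈ 𝔞, ∃ k : ℕ, x ^ k ∈ 𝔠) :
    ∃ k, 𝔞 ^ k ≤ 𝔠 :=
  Ideal.exists_pow_le_of_le_radical_of_fg h 𝔞.fg_of_isNoetherianRing

theorem pow_mem_ann_ker (x : A) (l : ℕ) :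
    x ^ l ∈ Module.annihilator A (LinearMap.ker (LinearMap.lsmul A M (x ^ l))) := by
  rw [Module.mem_annihilator]
  rintro ⟨m, hm⟩
  exact Subtype.ext hm

theorem pow_mem_ann_coker (x : A) (l : ℕ) :
    x ^ l ∈ Module.annihilator A (M ⧸ LinearMap.range (LinearMap.lsmul A M (x ^ l))) := by
  rw [Module.mem_annihilator]
  intro m
  obtain ⟨m, rfl⟩ := Submodule.mkQ_surjective _ m
  rw [← map_smul]
  exact (Submodule.Quotient.mk_eq_zero _).2 ⟨m, rfl⟩

theorem lt_of_mem_not_mem {I J : Ideal A} (h : I ≤ J) {x : A} (hx : x ∈ J) (hx' : x ∉ I) : I < J :=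
  lt_of_le_of_ne h fun e => hx' (e ▸ hx)

theorem AR.of_art [IsNoetherianRing A] {𝔞 : Ideal A} (hS : SInv S M) (ht : ITor 𝔞 M)
    (ha : (art A S).mem M) (i : ℕ) : AR 𝔞 (i + 1) M := by
  have main : ∀ 𝔠 : Ideal A, ∀ (W : Type) [AddCommGroup W] [Module A W],
      Module.annihilator A W = 𝔠 → SInv S W → ITor 𝔞 W → (art A S).mem W → AR 𝔞 (i + 1) W := by
    intro 𝔠
    induction 𝔠 using WellFoundedGT.induction with
    | _ 𝔠 ih =>
    intro W _ _ hW hS ht ha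
    by_cases hn : ∀ x ∈ 𝔞, ∃ k : ℕ, x ^ k ∈ Module.annihilator A W
    · obtain ⟨k, hk⟩ := exists_pow_le_ann hn
      exact AR.of_pow k hk i
    push Not at hn
    obtain ⟨x, hx, hxn⟩ := hn
    obtain ⟨k, hk⟩ := ha (fun k => LinearMap.range (LinearMap.lsmul A W (x ^ k))) (by
      intro a b hab
      rintro _ ⟨w, rfl⟩
      refine ⟨x ^ (b - a) • w, ?_⟩
      simp only [LinearMap.lsmul_apply, smul_smul, ← pow_add]
      congr 2; lia)
    set D := LinearMap.range (LinearMap.lsmul A W (x ^ k)) with hD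
    have hDsat : satS S D ≤ D := hS.sat_range hS _
    have hDS : SInv S D := hS.sub D hDsat
    have hDx : ∀ l : ℕ, ∀ d ∈ D, ∃ d' ∈ D, x ^ l • d' = d := by
      intro l d hd
      obtain ⟨s, hs, hsd⟩ := hk (k + l) (by lia) d hd
      obtain ⟨w, hw⟩ := hS.sat_range hS _ ⟨s, hs, hsd⟩
      refine ⟨x ^ k • w, ⟨w, rfl⟩, ?_⟩
      rw [smul_smul, ← pow_add, add_comm]
      exact hw
    have hDt : ITor 𝔞 D := ht.of_inj D.subtype D.subtype_injective
    have hDa := (art A S).of_sub D ha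
    refine AR.mid (SES.quot D) ?_ ?_
    · refine AR.of_smul hx ?_ ?_
      · intro l
        refine ih _ ?_ _ rfl ?_ ?_ ?_
        · refine lt_of_mem_not_mem (x := x ^ l) ?_ (pow_mem_ann_ker x l) (hW ▸ hxn l)
          rw [← hW]
          exact (annihilator_sub D).trans (annihilator_sub _)
        · exact hDS.sub _ (hDS.sat_ker _)
        · exact hDt.of_inj (Submodule.subtype _) (Submodule.subtype_injective _)
        · exact (art A S).of_sub _ hDa
      · intro l
        have : Subsingleton (D ⧸ LinearMap.range (LinearMap.lsmul A D (x ^ l))) := by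
          rw [Submodule.Quotient.subsingleton_iff, eq_top_iff]
          rintro ⟨d, hd⟩ _
          obtain ⟨d', hd', e⟩ := hDx l d hd
          exact ⟨⟨d', hd'⟩, Subtype.ext e⟩
        exact AR.zero _
    · refine ih _ ?_ _ rfl ?_ ?_ ?_
      · refine lt_of_mem_not_mem (x := x ^ k) ?_ (pow_mem_ann_coker x k) (hW ▸ hxn k)
        rw [← hW]
        exact annihilator_quot D
      · exact hS.quot D hDsat
      · exact ht.of_surj D.mkQ D.mkQ_surjective
      · exact (art A S).of_quot D ha
  exact main _ M rfl hS ht ha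

/-- A f.g. torsion module is killed by a power. -/
theorem ITor.exists_pow {𝔞 : Ideal A} (ht : ITor 𝔞 M) (F : Submodule A M) (hF : F.FG) :
    ∃ k, ∀ a ∈ 𝔞 ^ k, ∀ m ∈ F, a • m = 0 := by
  induction F, hF using Submodule.fg_induction with
  | singleton x =>
    obtain ⟨n, hn⟩ := ht x
    refine ⟨n, fun a ha m hm => ?_⟩
    obtain ⟨c, rfl⟩ := Submodule.mem_span_singleton.1 hm
    rw [smul_comm, hn a ha, smul_zero]
  | sup F G _ _ h1 h2 =>
    obtain ⟨n1, h1⟩ := h1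
    obtain ⟨n2, h2⟩ := h2
    refine ⟨max n1 n2, fun a ha m hm => ?_⟩
    obtain ⟨u, hu, v, hv, rfl⟩ := Submodule.mem_sup.1 hm
    rw [smul_add, h1 a (Ideal.pow_le_pow_right (le_max_left _ _) ha) u hu,
      h2 a (Ideal.pow_le_pow_right (le_max_right _ _) ha) v hv, add_zero]

/-- `V(𝔟)` has dimension at most one away from `S`. -/
def HCond1 (S : Submonoid A) (𝔟 : Ideal A) : Prop :=
  ∀ p q r : Ideal A, p.IsPrime → q.IsPrime → r.IsPrime → 𝔟 ≤ p → p < q → q < r →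
    ∃ s ∈ S, s ∈ r

theorem AR.Z [IsNoetherianRing A] {𝔞 𝔟 : Ideal A} (hb : 𝔟 ≤ 𝔞 ⊔ Module.annihilator A M)
    (hab : 𝔞 ≤ 𝔟)
    (hS : SInv S M) (ht : ITor 𝔞 M) (hc : HCond1 S 𝔟)
    (hp : ∀ p : Ideal A, (hp : p.IsPrime) → p ∈ 𝔟.minimalPrimes → (∀ s ∈ S, s ∉ p) →
      (noe A p.primeCompl).mem M)
    (h0 : (noe A S).mem (EX A (A ⧸ 𝔞) M 0)) (i : ℕ) : AR 𝔞 (i + 1) M := by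
  classical
  -- the f.g. submodule
  obtain ⟨F, hF, hFp⟩ : ∃ F : Submodule A M, F.FG ∧ ∀ p : Ideal A, p ∈ 𝔟.minimalPrimes →
      (∀ s ∈ S, s ∉ p) → ∀ m : M, ∃ u, u ∉ p ∧ u • m ∈ F := by
    have hfin := Ideal.finite_minimalPrimes_of_isNoetherianRing A 𝔟
    have : ∀ p : Ideal A, ∃ F : Submodule A M, F.FG ∧ (p ∈ 𝔟.minimalPrimes →
      (∀ s ∈ S, s ∉ p) → ∀ m : M, ∃ u, u ∉ p ∧ u • m ∈ F) := by
      intro p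
      by_cases h : p ∈ 𝔟.minimalPrimes ∧ (∀ s ∈ S, s ∉ p)
      · have : p.IsPrime := h.1.1.1
        obtain ⟨F, hF, H⟩ := hp p this h.1 h.2
        exact ⟨F, hF, fun _ _ m => H m⟩
      · exact ⟨⊥, Submodule.fg_bot, fun h1 h2 => absurd ⟨h1, h2⟩ h⟩
    choose F hF H using this
    refine ⟨hfin.toFinset.sup F, ?_, ?_⟩
    · exact Submodule.fg_finset_sup _ _ fun p _ => hF p
    · intro p hp hpS m
      obtain ⟨u, hu, hm⟩ := H p hp hpS m
      exact ⟨u, hu, (Finset.le_sup (f := F) (hfin.mem_toFinset.2 hp)) hm⟩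
  set L := satS S F with hL
  have hLsat : satS S L ≤ L := by rw [hL, satS_satS]
  have hLS := hS.sub L hLsat
  obtain ⟨k, hk⟩ := ht.exists_pow F hF
  refine AR.mid (SES.quot L) (AR.of_pow k ?_ i) ?_
  · intro a ha
    rw [Module.mem_annihilator]
    rintro ⟨m, s, hs, hm⟩
    apply Subtype.ext
    apply (hS s hs).1
    change s • a • m = s • (0 : M)
    rw [smul_comm, hk a ha _ hm, smul_zero]
  have hLn : (noe A S).mem L := by
    refine ⟨F.comap L.subtype, ?_, ?_⟩
    · have e : F = (F.comap L.subtype).map L.subtype := by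
        rw [Submodule.map_comap_eq, Submodule.range_subtype, inf_eq_right.2 le_satS]
      rw [e] at hF
      exact Submodule.fg_of_fg_map_injective _ L.subtype_injective hF
    · rintro ⟨m, s, hs, hm⟩
      exact ⟨s, hs, hm⟩
  have hQt : ITor 𝔞 (M ⧸ L) := ht.of_surj L.mkQ L.mkQ_surjective
  have hQ0 : (noe A S).mem (tsub 𝔞 (M ⧸ L)) := by
    refine (noe A S).of_equiv (EX.tsubEquiv 𝔞 (M ⧸ L)) ?_
    exact (noe A S).mid _ _ (EX.co3 (SES.quot L) _ 0) h0 ((noe A S).ext hLn 1 _)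
  refine AR.of_art (hS.quot L hLsat) hQt (art_of_tsub 𝔞 hQt ?_) i
  obtain ⟨F', hF', hFt⟩ := noe_quot hQ0
  refine (art A S).mid (M' := F') F'.subtype F'.mkQ (LinearMap.exact_subtype_mkQ F') ?_
    (art_of_tor hFt)
  have : Module.Finite A F' := Module.Finite.of_fg hF'
  have hb' : 𝔟 ≤ Module.annihilator A F' := by
    refine hb.trans (sup_le ?_ ?_)
    · refine le_trans ?_ (annihilator_sub _)
      intro a ha
      rw [Module.mem_annihilator]
      intro m
      exact Subtype.ext (m.2 a ha)
    · exact (annihilator_quot L).trans ((annihilator_sub _).trans (annihilator_sub _))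
  refine art_of_noe (𝔟 := Module.annihilator A F') ?_ le_rfl (noe_of_finite _ this)
  intro q q' hq hq' hle hqq hd
  by_contra hne
  obtain ⟨p, hpm, hpq⟩ := Ideal.exists_minimalPrimes_le (hb'.trans hle)
  have hpp : p.IsPrime := hpm.1.1
  have hpS : ∀ s ∈ S, s ∉ p := fun s hs hsp => hd s hs (hqq (hpq hsp))
  have hnp : ¬ Module.annihilator A F' ≤ p := by
    intro hann
    have hpsupp : (⟨p, hpp⟩ : PrimeSpectrum A) ∈ Module.support A F' := by
      rw [Module.support_eq_zeroLocus]
      exact hann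
    rw [Module.mem_support_iff'] at hpsupp
    obtain ⟨⟨⟨m, hm⟩, hm'⟩, hmm⟩ := hpsupp
    obtain ⟨m, rfl⟩ := L.mkQ_surjective m
    obtain ⟨u, hu, hum⟩ := hFp p hpm hpS m
    apply hmm u hu
    apply Subtype.ext
    apply Subtype.ext
    change u • L.mkQ m = 0
    rw [← map_smul]
    exact (Submodule.Quotient.mk_eq_zero _).2 (le_satS hum)
  have hpq' : p < q := lt_of_le_of_ne hpq fun e => hnp (e ▸ hle)
  obtain ⟨s, hs, hsq⟩ := hc p q q' hpp hq hq' hpm.1.2 hpq' (lt_of_le_of_ne hqq hne)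
  exact hd s hs hsq

end SInvSec

section BNsec

open SerreCl

variable {S : Submonoid A} {M N : Type} [AddCommGroup M] [Module A M] [AddCommGroup N] [Module A N]

/-- image under multiplication -/
abbrev smulSub (r : A) (L : Submodule A M) : Submodule A M := L.map (LinearMap.lsmul A M r)

theorem smulSub_mono (r : A) {L L' : Submodule A M} (h : L ≤ L') : smulSub r L ≤ smulSub r L' :=
  Submodule.map_mono h

theorem smulSub_le (r : A) {L : Submodule A M} : smulSub r L ≤ L := by
  rintro _ ⟨y, hy, rfl⟩
  exact Submodule.smul_mem _ _ hy

theorem art_wf (ha : (art A S).mem M) :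
    WellFounded fun L1 L2 : Submodule A M => L1 ≤ L2 ∧ ¬ L2 ≤ satS S L1 := by
  rw [wellFounded_iff_isEmpty_descending_chain]
  constructor
  rintro ⟨f, hf⟩
  obtain ⟨n, hn⟩ := ha f (antitone_nat_of_succ_le fun n => (hf n).1)
  exact (hf n).2 (hn (n + 1) (by lia))

/-- `L/xL` is finitely generated at `S` for almost all `x ∈ 𝔞`. -/
theorem generic_aux [IsNoetherianRing A] {𝔞 𝔟 : Ideal A} (h : HCond S 𝔟)
    (hb : 𝔟 ≤ 𝔞 ⊔ Module.annihilator A M) (ha : (art A S).mem M) (L : Submodule A M) :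
    ∃ Q : Finset (Ideal A), (∀ q ∈ Q, q.IsPrime ∧ ¬ 𝔞 ≤ q) ∧ ∀ x ∈ 𝔞, (∀ q ∈ Q, x ∉ q) → ∀ l : ℕ,
      ∃ F : Submodule A M, F.FG ∧ L ≤ satS S (F ⊔ smulSub (x ^ l) L) := by
  classical
  induction L using (art_wf ha).induction with
  | _ L ih =>
  by_cases hd : ∃ r : A, (∀ k : ℕ, ¬ smulSub (r ^ k) L ≤ satS S ⊥) ∧ ¬ L ≤ satS S (smulSub r L)
  · obtain ⟨r, hr1, hr2⟩ := hd
    obtain ⟨k, hk⟩ := ha (fun k => smulSub (r ^ k) L) (by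
      intro a b hab
      rintro _ ⟨w, hw, rfl⟩
      refine ⟨r ^ (b - a) • w, Submodule.smul_mem _ _ hw, ?_⟩
      simp only [LinearMap.lsmul_apply, smul_smul, ← pow_add]
      congr 2; lia)
    obtain ⟨k, hk, hk0⟩ : ∃ k, (∀ y ∈ L, ∃ s ∈ S, ∃ z ∈ L, s • r ^ k • y = r ^ (2 * k) • z) ∧
        k ≠ 0 := by
      refine ⟨k + 1, fun y hy => ?_, by lia⟩
      obtain ⟨s, hs, z, hz, e⟩ := hk (2 * (k + 1)) (by lia) (r ^ k • (r • y))
        ⟨r • y, Submodule.smul_mem _ _ hy, rfl⟩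
      refine ⟨s, hs, z, hz, ?_⟩
      rw [pow_succ, mul_smul]
      exact e.symm
    set L1 := L ⊓ LinearMap.ker (LinearMap.lsmul A M (r ^ k)) with hL1
    set L2 := smulSub (r ^ k) L with hL2
    have hL : L ≤ satS S (L1 ⊔ L2) := by
      intro y hy
      obtain ⟨s, hs, z, hz, e⟩ := hk y hy
      refine ⟨s, hs, ?_⟩
      have h1 : s • y - r ^ k • z ∈ L1 := by
        refine ⟨Submodule.sub_mem _ (Submodule.smul_mem _ _ hy) (Submodule.smul_mem _ _ hz), ?_⟩
        change r ^ k • (s • y - r ^ k • z) = 0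
        rw [smul_sub, smul_comm, e, smul_smul, ← pow_add, two_mul, sub_self]
      have h2 : r ^ k • z ∈ L2 := ⟨z, hz, rfl⟩
      have := Submodule.add_mem_sup h1 h2
      rwa [sub_add_cancel] at this
    obtain ⟨Q1, hQ1, H1⟩ := ih L1 ⟨inf_le_left, fun hc => hr1 k (by
      rintro _ ⟨y, hy, rfl⟩
      obtain ⟨s, hs, hsy⟩ := hc hy
      refine ⟨s, hs, ?_⟩
      rw [Submodule.mem_bot]
      change s • r ^ k • y = 0
      rw [smul_comm]
      exact hsy.2)⟩
    obtain ⟨Q2, hQ2, H2⟩ := ih L2 ⟨smulSub_le _, fun hc => hr2 (hc.trans (satS_mono (by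
      rintro _ ⟨y, hy, rfl⟩
      refine ⟨r ^ (k - 1) • y, Submodule.smul_mem _ _ hy, ?_⟩
      simp only [LinearMap.lsmul_apply, smul_smul, ← pow_succ']
      congr 2; lia)))⟩
    refine ⟨Q1 ∪ Q2, ?_, ?_⟩
    · intro q hq
      rcases Finset.mem_union.1 hq with hq | hq
      · exact hQ1 q hq
      · exact hQ2 q hq
    · intro x hx hxQ l
      obtain ⟨F1, hF1, e1⟩ := H1 x hx (fun q hq => hxQ q (Finset.mem_union_left _ hq)) l
      obtain ⟨F2, hF2, e2⟩ := H2 x hx (fun q hq => hxQ q (Finset.mem_union_right _ hq)) l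
      refine ⟨F1 ⊔ F2, hF1.sup hF2, ?_⟩
      rw [← satS_satS]
      refine hL.trans (satS_mono (sup_le (e1.trans (satS_mono ?_)) (e2.trans (satS_mono ?_))))
      · exact sup_le_sup le_sup_left (smulSub_mono _ inf_le_left)
      · exact sup_le_sup le_sup_right (smulSub_mono _ (smulSub_le _))
  · push Not at hd
    set 𝔫 : Ideal A := (satS S (⊥ : Submodule A M)).colon L with hn
    have hmem : ∀ r, r ∈ 𝔫 ↔ ∀ y ∈ L, r • y ∈ satS S (⊥ : Submodule A M) := fun r =>
      Submodule.mem_colon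
    have hdich : ∀ r, r ∈ 𝔫.radical ∨ L ≤ satS S (smulSub r L) := by
      intro r
      by_cases hr : ∀ k : ℕ, ¬ smulSub (r ^ k) L ≤ satS S ⊥
      · exact Or.inr (hd r hr)
      · push Not at hr
        obtain ⟨k, hk⟩ := hr
        exact Or.inl ⟨k, (hmem _).2 fun y hy => hk ⟨y, hy, rfl⟩⟩
    have hsurj : ∀ r, L ≤ satS S (smulSub r L) → ∀ k : ℕ, L ≤ satS S (smulSub (r ^ k) L) := by
      intro r hr k
      induction k with
      | zero =>
        intro y hy
        exact ⟨1, S.one_mem, y, hy, by simp⟩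
      | succ k ih =>
        intro y hy
        obtain ⟨s, hs, z, hz, e⟩ := hr hy
        obtain ⟨t, ht, w, hw, e'⟩ := ih hz
        refine ⟨t * s, S.mul_mem ht hs, w, hw, ?_⟩
        rw [LinearMap.lsmul_apply] at e e' ⊢
        rw [mul_smul, ← e, smul_comm, ← e', smul_smul, ← pow_succ']
    by_cases ht : 𝔫.radical = ⊤
    · refine ⟨∅, by simp, fun x _ _ l => ⟨⊥, Submodule.fg_bot, ?_⟩⟩
      rw [Ideal.radical_eq_top] at ht
      have h1 : (1 : A) ∈ 𝔫 := ht ▸ Submodule.mem_top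
      intro y hy
      have := (hmem 1).1 h1 y hy
      rw [one_smul] at this
      exact satS_mono bot_le this
    have hprime : 𝔫.radical.IsPrime := by
      refine Ideal.isPrime_iff.2 ⟨ht, ?_⟩
      rintro r r' ⟨k, hk⟩
      rcases hdich r with hr | hr
      · exact Or.inl hr
      · right
        refine ⟨k, (hmem _).2 fun y hy => ?_⟩
        obtain ⟨s, hs, z, hz, e⟩ := hsurj r hr k hy
        obtain ⟨t, ht, e'⟩ := (hmem _).1 hk z hz
        rw [Submodule.mem_bot] at e'
        refine ⟨t * s, S.mul_mem ht hs, ?_⟩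
        rw [Submodule.mem_bot, mul_smul, smul_comm s, ← e, LinearMap.lsmul_apply, smul_smul (r' ^ k),
          ← mul_pow, mul_comm r', e']
    by_cases hle : 𝔞 ≤ 𝔫.radical
    · obtain ⟨K, hK⟩ := Ideal.exists_pow_le_of_le_radical_of_fg hle 𝔞.fg_of_isNoetherianRing
      refine ⟨∅, by simp, fun x _ _ l => ?_⟩
      set T := satS S (⊥ : Submodule A L) with hT
      have hTt : (tor S).mem T := by
        rintro ⟨y, s, hs, hy⟩
        exact ⟨s, hs, Subtype.ext hy⟩
      have hnoe : (noe A S).mem L := by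
        refine (noe A S).mid T.subtype T.mkQ (LinearMap.exact_subtype_mkQ T) (noe_of_tor hTt) ?_
        refine noe_of_art (𝔟 := 𝔞 ^ K ⊔ Module.annihilator A M) ?_ ?_
          ((art A S).of_quot T ((art A S).of_sub L ha))
        · intro p q hp hq hpb hpq hqs
          refine h p q hp hq (hb.trans (sup_le ?_ (le_sup_right.trans hpb))) hpq hqs
          exact hp.le_of_pow_le (le_sup_left.trans hpb)
        · refine sup_le ?_ ((annihilator_sub L).trans (annihilator_quot T))
          intro a ha
          rw [Module.mem_annihilator]
          intro y
          obtain ⟨y, rfl⟩ := T.mkQ_surjective y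
          rw [← map_smul]
          refine (Submodule.Quotient.mk_eq_zero _).2 ?_
          obtain ⟨s, hs, e⟩ := (hmem _).1 (hK ha) y.1 y.2
          exact ⟨s, hs, Subtype.ext e⟩
      obtain ⟨F, hF, H⟩ := hnoe
      refine ⟨F.map L.subtype, hF.map _, fun y hy => ?_⟩
      obtain ⟨s, hs, hsy⟩ := H ⟨y, hy⟩
      exact ⟨s, hs, Submodule.mem_sup_left ⟨_, hsy, rfl⟩⟩
    · refine ⟨{𝔫.radical}, ?_, ?_⟩
      · intro q hq
        rw [Finset.mem_singleton] at hq
        subst hq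
        exact ⟨hprime, hle⟩
      · intro x _ hx l
        have hx' := hx _ (Finset.mem_singleton_self _)
        refine ⟨⊥, Submodule.fg_bot, ?_⟩
        rw [bot_sup_eq]
        exact hsurj x ((hdich x).resolve_left hx') l

theorem generic_quot [IsNoetherianRing A] {𝔞 𝔟 : Ideal A} (h : HCond S 𝔟)
    (hb : 𝔟 ≤ 𝔞 ⊔ Module.annihilator A M) (ha : (art A S).mem M) :
    ∃ Q : Finset (Ideal A), (∀ q ∈ Q, q.IsPrime ∧ ¬ 𝔞 ≤ q) ∧ ∀ x ∈ 𝔞, (∀ q ∈ Q, x ∉ q) → ∀ l : ℕ,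
      (noe A S).mem (M ⧸ LinearMap.range (LinearMap.lsmul A M (x ^ l))) := by
  obtain ⟨Q, hQ, H⟩ := generic_aux h hb ha ⊤
  refine ⟨Q, hQ, fun x hx hxQ l => ?_⟩
  obtain ⟨F, hF, e⟩ := H x hx hxQ l
  refine ⟨F.map (Submodule.mkQ _), hF.map _, fun m => ?_⟩
  obtain ⟨m, rfl⟩ := Submodule.mkQ_surjective _ m
  obtain ⟨s, hs, hm⟩ := e (Submodule.mem_top (x := m))
  refine ⟨s, hs, ?_⟩
  obtain ⟨f, hf, _, ⟨z, _, rfl⟩, e⟩ := Submodule.mem_sup.1 hm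
  refine ⟨f, hf, ?_⟩
  rw [← map_smul, ← e, map_add]
  have : (LinearMap.range (LinearMap.lsmul A M (x ^ l))).mkQ (LinearMap.lsmul A M (x ^ l) z) = 0 :=
    (Submodule.Quotient.mk_eq_zero _).2 ⟨z, rfl⟩
  rw [this, add_zero]

theorem AR.BN [IsNoetherianRing A] {𝔞 𝔟 J : Ideal A} (hb : 𝔟 = 𝔞 ⊔ J)
    (hJ : J ≤ Module.annihilator A M)
    (hS : SInv S M) (ht : ITor 𝔞 M) (hc : HCond1 S 𝔟)
    (h0 : (noe A S).mem (EX A (A ⧸ 𝔞) M 0)) (h1 : (noe A S).mem (EX A (A ⧸ 𝔞) M 1)) (i : ℕ) :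
    AR 𝔞 (i + 2) M := by
  classical
  have main : ∀ 𝔠 : Ideal A, ∀ (M : Type) [AddCommGroup M] [Module A M],
      Module.annihilator A M = 𝔠 → J ≤ Module.annihilator A M → SInv S M → ITor 𝔞 M →
      (noe A S).mem (EX A (A ⧸ 𝔞) M 0) → (noe A S).mem (EX A (A ⧸ 𝔞) M 1) →
      ∀ i, AR 𝔞 (i + 2) M := by
    intro 𝔠
    induction 𝔠 using WellFoundedGT.induction with
    | _ 𝔠 ih =>
    intro M _ _ hM hJ hS ht h0 h1 i
    have hab : 𝔞 ≤ 𝔟 := hb ▸ le_sup_left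
    have hbM : 𝔟 ≤ 𝔞 ⊔ Module.annihilator A M := hb ▸ sup_le_sup_left hJ _
    -- choose x
    have hfin := Ideal.finite_minimalPrimes_of_isNoetherianRing A 𝔟
    have hQ : ∀ p : Ideal A, ∃ Q : Finset (Ideal A), (∀ q ∈ Q, q.IsPrime ∧ ¬ 𝔞 ≤ q) ∧
        ∀ (hp : p.IsPrime), p ∈ 𝔟.minimalPrimes → (∀ s ∈ S, s ∉ p) →
        ∀ x ∈ 𝔞, (∀ q ∈ Q, x ∉ q) → ∀ l : ℕ, (noe A p.primeCompl).mem
          (M ⧸ LinearMap.range (LinearMap.lsmul A M (x ^ l))) := by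
      intro p
      by_cases h : p ∈ 𝔟.minimalPrimes ∧ (∀ s ∈ S, s ∉ p)
      · have hpp : p.IsPrime := h.1.1.1
        have hH : HCond p.primeCompl 𝔟 := by
          intro q q' hq hq' hbq hqq hd
          have hq'p : q' ≤ p := fun a ha => by
            by_contra hap
            exact hd a hap ha
          have h2 : p ≤ q := h.1.2 ⟨hq, hbq⟩ (hqq.trans hq'p)
          exact le_antisymm hqq (hq'p.trans h2)
        have hart : (art A p.primeCompl).mem M := by
          refine art_of_tsub 𝔞 ht (art_of_noe hH ?_ (noe_mono (S := S) (fun s hs => h.2 s hs)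
            ((noe A S).of_equiv (EX.tsubEquiv 𝔞 M) h0)))
          refine hbM.trans (sup_le ?_ (annihilator_sub _))
          intro a ha
          rw [Module.mem_annihilator]
          intro m
          exact Subtype.ext (m.2 a ha)
        obtain ⟨Q, hQ, H⟩ := generic_quot hH hbM hart
        exact ⟨Q, hQ, fun _ _ _ => H⟩
      · exact ⟨∅, by simp, fun _ h1 h2 => absurd ⟨h1, h2⟩ h⟩
    choose Q hQp hQ using hQ
    obtain ⟨x, hx, hxQ⟩ : ∃ x ∈ 𝔞, ∀ p ∈ 𝔟.minimalPrimes, ∀ q ∈ Q p, x ∉ q := by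
      by_contra! hcon
      have hsub : (𝔞 : Set A) ⊆ ⋃ q ∈ (↑(hfin.toFinset.biUnion Q) : Set (Ideal A)), (q : Set A) := by
        intro x hx
        obtain ⟨p, hp, q, hq, hxq⟩ := hcon x hx
        simp only [Set.mem_iUnion]
        exact ⟨q, Finset.mem_coe.2 (Finset.mem_biUnion.2 ⟨p, hfin.mem_toFinset.2 hp, hq⟩), hxq⟩
      obtain ⟨q, hq, hle⟩ := (Ideal.subset_union_prime (f := fun q : Ideal A => q) ⊥ ⊥ (by
        intro q hq _ _
        obtain ⟨p, _, hq⟩ := Finset.mem_biUnion.1 hq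
        exact (hQp p q hq).1)).1 hsub
      obtain ⟨p, _, hq⟩ := Finset.mem_biUnion.1 hq
      exact (hQp p q hq).2 hle
    have hquot : ∀ l : ℕ, ∀ p : Ideal A, (hp : p.IsPrime) → p ∈ 𝔟.minimalPrimes →
        (∀ s ∈ S, s ∉ p) → (noe A p.primeCompl).mem
          (M ⧸ LinearMap.range (LinearMap.lsmul A M (x ^ l))) :=
      fun l p hp hpm hpS => hQ p hp hpm hpS x hx (hxQ p hpm) l
    by_cases hnil : ∃ l : ℕ, x ^ l ∈ Module.annihilator A M
    · obtain ⟨l, hl⟩ := hnil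
      refine AR.Z hbM hab hS ht hc ?_ h0 (i + 1)
      intro p hp hpm hpS
      refine (noe A p.primeCompl).of_equiv (Submodule.quotEquivOfEqBot _ ?_) (hquot l p hp hpm hpS)
      rw [LinearMap.range_eq_bot]
      ext m
      exact Module.mem_annihilator.1 hl m
    · push Not at hnil
      have hkey : ∀ l : ℕ, (∀ i, AR 𝔞 (i + 2) (LinearMap.ker (LinearMap.lsmul A M (x ^ l)))) ∧
          (∀ i, AR 𝔞 (i + 1) (M ⧸ LinearMap.range (LinearMap.lsmul A M (x ^ l)))) := by
        intro l
        set φ := LinearMap.lsmul A M (x ^ l) with hφ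
        have S1 : SES (LinearMap.ker φ).subtype φ.rangeRestrict :=
          ⟨Submodule.subtype_injective _, by
            rw [LinearMap.exact_iff, Submodule.range_subtype, LinearMap.ker_rangeRestrict],
            LinearMap.surjective_rangeRestrict φ⟩
        have S2 := SES.quot (LinearMap.range φ)
        have k0 : (noe A S).mem (EX A (A ⧸ 𝔞) (LinearMap.ker φ) 0) :=
          (noe A S).of_inj _ (EX.post_inj _ S1.inj) h0
        have k0' : (noe A S).mem (EX A (A ⧸ 𝔞) (LinearMap.range φ) 0) :=
          (noe A S).of_inj _ (EX.post_inj _ S2.inj) h0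
        have k1 : (noe A S).mem (EX A (A ⧸ 𝔞) (LinearMap.ker φ) 1) :=
          (noe A S).mid _ _ (EX.co1 S1 _ 0) k0' h1
        have hAR : ∀ i, AR 𝔞 (i + 2) (LinearMap.ker φ) := by
          refine ih _ ?_ _ rfl ?_ ?_ ?_ k0 k1
          · refine lt_of_mem_not_mem (x := x ^ l) ?_ (pow_mem_ann_ker x l) (hM ▸ hnil l)
            rw [← hM]
            exact annihilator_sub _
          · exact hJ.trans (annihilator_sub _)
          · exact hS.sub _ (hS.sat_ker _)
          · exact ht.of_inj (Submodule.subtype _) (Submodule.subtype_injective _)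
        refine ⟨hAR, ?_⟩
        have kall := AR.mem_all (noe A S) 1 (fun i hi => by
          obtain ⟨j, rfl⟩ : ∃ j, i = j + 1 := ⟨i - 1, by lia⟩
          exact hAR j) (M := LinearMap.ker φ) (by
          intro j hj
          interval_cases j
          · exact k0
          · exact k1)
        have k1' : (noe A S).mem (EX A (A ⧸ 𝔞) (LinearMap.range φ) 1) :=
          (noe A S).mid _ _ (EX.co3 S1 _ 1) h1 (kall 2)
        have kq : (noe A S).mem (EX A (A ⧸ 𝔞) (M ⧸ LinearMap.range φ) 0) :=
          (noe A S).mid _ _ (EX.co3 S2 _ 0) h0 k1'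
        refine AR.Z ?_ hab (hS.quot _ (hS.sat_range hS _)) (ht.of_surj _ (Submodule.mkQ_surjective _))
          hc (hquot l) kq
        exact hbM.trans (sup_le_sup_left (annihilator_quot _) _)
      exact AR.of_smul hx (fun l => (hkey l).1 i) (fun l => (hkey l).2 i)
  exact main _ M rfl hJ hS ht h0 h1 i

end BNsec

section LocSec

open SerreCl

/-- The localization sequence of a module `X` at `S`. -/
structure LocSeq (S : Submonoid A) {G X B Y H : Type} [AddCommGroup G] [Module A G]
    [AddCommGroup X] [Module A X] [AddCommGroup B] [Module A B] [AddCommGroup Y] [Module A Y]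
    [AddCommGroup H] [Module A H] (i : G →ₗ[A] X) (p : X →ₗ[A] B) (j : B →ₗ[A] Y)
    (q : Y →ₗ[A] H) : Prop where
  s1 : SES i p
  s2 : SES j q
  tG : (tor S).mem G
  tH : (tor S).mem H
  inv : SInv S Y

theorem locSeq (S : Submonoid A) (X : Type) [AddCommGroup X] [Module A X] :
    LocSeq S (LinearMap.ker (LocalizedModule.mkLinearMap S X)).subtype
      (LocalizedModule.mkLinearMap S X).rangeRestrict
      (LinearMap.range (LocalizedModule.mkLinearMap S X)).subtype
      (LinearMap.range (LocalizedModule.mkLinearMap S X)).mkQ where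
  s1 := ⟨Submodule.subtype_injective _, by
            rw [LinearMap.exact_iff, Submodule.range_subtype, LinearMap.ker_rangeRestrict],
            LinearMap.surjective_rangeRestrict _⟩
  s2 := SES.quot _
  tG := by
    rintro ⟨m, hm⟩
    obtain ⟨c, hc⟩ := (IsLocalizedModule.eq_zero_iff S (LocalizedModule.mkLinearMap S X)).1 hm
    exact ⟨c, c.2, Subtype.ext hc⟩
  tH := by
    intro m
    obtain ⟨m, rfl⟩ := Submodule.mkQ_surjective _ m
    obtain ⟨⟨u, s⟩, hu⟩ := IsLocalizedModule.surj S (LocalizedModule.mkLinearMap S X) m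
    refine ⟨s, s.2, ?_⟩
    rw [← map_smul]
    exact (Submodule.Quotient.mk_eq_zero _).2 ⟨u, hu.symm⟩
  inv := by
    intro s hs
    exact (Module.End.isUnit_iff _).1
      (IsLocalizedModule.map_units (LocalizedModule.mkLinearMap S X) ⟨s, hs⟩)

variable {S : Submonoid A} {G X B Y H : Type} [AddCommGroup G] [Module A G]
    [AddCommGroup X] [Module A X] [AddCommGroup B] [Module A B] [AddCommGroup Y] [Module A Y]
    [AddCommGroup H] [Module A H] {i : G →ₗ[A] X} {p : X →ₗ[A] B} {j : B →ₗ[A] Y}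
    {q : Y →ₗ[A] H}

namespace LocSeq

theorem ar (h : LocSeq S i p j q) {𝔞 : Ideal A} {n : ℕ} (h1 : AR 𝔞 (n + 1) G)
    (h2 : AR 𝔞 (n + 1) Y) (h3 : AR 𝔞 n H) : AR 𝔞 (n + 1) X :=
  AR.mid h.s1 h1 (AR.left h.s2 h2 h3)

theorem exists_lift (h : LocSeq S i p j q) (y : Y) : ∃ s ∈ S, ∃ x : X, s • y = j (p x) := by
  obtain ⟨s, hs, e⟩ := h.tH (q y)
  rw [← map_smul] at e
  obtain ⟨b, hb⟩ := (h.s2.ex _).1 e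
  obtain ⟨x, rfl⟩ := h.s1.surj b
  exact ⟨s, hs, x, hb.symm⟩

theorem annG (h : LocSeq S i p j q) : Module.annihilator A X ≤ Module.annihilator A G :=
  LinearMap.annihilator_le_of_injective i h.s1.inj

theorem annY (h : LocSeq S i p j q) : Module.annihilator A X ≤ Module.annihilator A Y := by
  intro a ha
  rw [Module.mem_annihilator]
  intro y
  obtain ⟨s, hs, x, e⟩ := h.exists_lift y
  apply (h.inv s hs).1
  change s • a • y = s • (0 : Y)
  rw [smul_comm, e, ← map_smul, ← map_smul, Module.mem_annihilator.1 ha, map_zero, map_zero,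
    smul_zero]

theorem annH (h : LocSeq S i p j q) : Module.annihilator A X ≤ Module.annihilator A H :=
  h.annY.trans (LinearMap.annihilator_le_of_surjective q h.s2.surj)

theorem torG (h : LocSeq S i p j q) {𝔟 : Ideal A} (ht : ITor 𝔟 X) : ITor 𝔟 G :=
  ht.of_inj i h.s1.inj

theorem torY (h : LocSeq S i p j q) {𝔟 : Ideal A} (ht : ITor 𝔟 X) : ITor 𝔟 Y := by
  intro y
  obtain ⟨s, hs, x, e⟩ := h.exists_lift y
  obtain ⟨n, hn⟩ := ht x
  refine ⟨n, fun a ha => (h.inv s hs).1 ?_⟩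
  change s • a • y = s • (0 : Y)
  rw [smul_comm, e, ← map_smul, ← map_smul, hn a ha, map_zero, map_zero, smul_zero]

theorem torH (h : LocSeq S i p j q) {𝔟 : Ideal A} (ht : ITor 𝔟 X) : ITor 𝔟 H :=
  (h.torY ht).of_surj q h.s2.surj

theorem artY (h : LocSeq S i p j q) (ha : (art A S).mem X) : (art A S).mem Y :=
  (art A S).mid j q h.s2.ex ((art A S).of_surj p h.s1.surj ha) (art_of_tor h.tH)

theorem noeY [IsNoetherianRing A] (h : LocSeq S i p j q) (N : Type) [AddCommGroup N] [Module A N]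
    [Module.Finite A N] (n : ℕ) (hX : (noe A S).mem (EX A N X n)) :
    (noe A S).mem (EX A N Y n) := by
  refine (noe A S).mid _ _ (EX.co2 h.s2 N n) ?_ (noe_of_tor ((tor S).ext h.tH n N))
  exact (noe A S).mid _ _ (EX.co3 h.s1 N n) hX (noe_of_tor ((tor S).ext h.tG (n + 1) N))

/-- if `N` is killed by an element of `S`, then `Ext(N, Y) = 0`. -/
theorem extY (h : LocSeq S i p j q) {N : Type} [AddCommGroup N] [Module A N] {s : A} (hs : s ∈ S)
    (hN : s ∈ Module.annihilator A N) (C : SerreCl A) (n : ℕ) : C.mem (EX A N Y n) := by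
  have : Subsingleton (EX A N Y n) := ⟨fun a b => by
    rw [EX.eq_zero_of (h.inv s hs) hN n a, EX.eq_zero_of (h.inv s hs) hN n b]⟩
  exact C.zero _

theorem extB0 (h : LocSeq S i p j q) {N : Type} [AddCommGroup N] [Module A N] {s : A} (hs : s ∈ S)
    (hN : s ∈ Module.annihilator A N) (C : SerreCl A) : C.mem (EX A N B 0) :=
  C.of_inj _ (EX.post_inj j h.s2.inj) (h.extY hs hN C 0)

theorem extH (h : LocSeq S i p j q) {N : Type} [AddCommGroup N] [Module A N] {s : A} (hs : s ∈ S)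
    (hN : s ∈ Module.annihilator A N) (C : SerreCl A) (n : ℕ) (hB : C.mem (EX A N B (n + 1))) :
    C.mem (EX A N H n) :=
  C.mid _ _ (EX.co3 h.s2 N n) (h.extY hs hN C n) hB

theorem extB (h : LocSeq S i p j q) {N : Type} [AddCommGroup N] [Module A N] {s : A} (hs : s ∈ S)
    (hN : s ∈ Module.annihilator A N) (C : SerreCl A) (n : ℕ) (hB : C.mem (EX A N H n)) :
    C.mem (EX A N B (n + 1)) :=
  C.mid _ _ (EX.co1 h.s2 N n) hB (h.extY hs hN C (n + 1))

end LocSeq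

theorem ITor.sup {𝔟 𝔠 : Ideal A} (h : ITor 𝔟 X) (h' : ITor 𝔠 X) : ITor (𝔟 ⊔ 𝔠) X := by
  intro x
  obtain ⟨m, hm⟩ := h x
  obtain ⟨n, hn⟩ := h' x
  refine ⟨m + n, fun a ha => ?_⟩
  obtain ⟨b, hb, c, hc, rfl⟩ := Submodule.mem_sup.1 (Ideal.sup_pow_add_le_pow_sup_pow ha)
  rw [add_smul, hm b hb, hn c hc, add_zero]

theorem ITor.of_ann {𝔟 : Ideal A} (h : 𝔟 ≤ Module.annihilator A X) : ITor 𝔟 X := fun x =>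
  ⟨1, fun a ha => Module.mem_annihilator.1 (h (by simpa using ha)) x⟩

theorem ITor.of_tor {y : A} (h : (tor (Submonoid.powers y)).mem X) : ITor (Ideal.span {y}) X := by
  intro x
  obtain ⟨_, ⟨n, rfl⟩, hx⟩ := h x
  refine ⟨n, fun a ha => ?_⟩
  rw [Ideal.span_singleton_pow] at ha
  obtain ⟨c, rfl⟩ := Ideal.mem_span_singleton'.1 ha
  rw [mul_smul, hx, smul_zero]

theorem ITor.of_pow_le {𝔟 𝔠 : Ideal A} {n : ℕ} (hn : 𝔠 ^ n ≤ 𝔟) (h : ITor 𝔟 X) : ITor 𝔠 X := by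
  intro x
  obtain ⟨m, hm⟩ := h x
  refine ⟨n * m, fun a ha => hm a ?_⟩
  rw [pow_mul] at ha
  exact Ideal.pow_right_mono hn m ha

theorem le_ann_tsub (𝔟 : Ideal A) : 𝔟 ≤ Module.annihilator A (tsub 𝔟 X) := by
  intro a ha
  rw [Module.mem_annihilator]
  intro m
  exact Subtype.ext (m.2 a ha)

theorem art_of_ext0 [IsNoetherianRing A] {𝔟 : Ideal A} (hH : HCond S 𝔟) (ht : ITor 𝔟 X)
    (h0 : (noe A S).mem (EX A (A ⧸ 𝔟) X 0)) : (art A S).mem X :=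
  art_of_tsub 𝔟 ht (art_of_noe hH (le_ann_tsub 𝔟) ((noe A S).of_equiv (EX.tsubEquiv 𝔟 X) h0))

theorem noe_ext_of_art [IsNoetherianRing A] {𝔟 : Ideal A} (hH : HCond S 𝔟)
    (ha : (art A S).mem X) (n : ℕ) : (noe A S).mem (EX A (A ⧸ 𝔟) X n) := by
  refine noe_of_art hH ?_ ((art A S).ext ha n _)
  intro a ha
  rw [Module.mem_annihilator]
  intro m
  exact EX.smul_eq_zero_left (by rwa [Ideal.annihilator_quotient]) n m

theorem HCond.of_max {𝔪 : Ideal A} [h𝔪 : 𝔪.IsMaximal] : HCond S 𝔪 := by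
  intro p q hp hq h1 h2 _
  rw [← h𝔪.eq_of_le hp.ne_top h1]
  exact h𝔪.eq_of_le hq.ne_top (h1.trans h2)

/-- first half: `X` a module supported on a curve -/
theorem LocSeq.half [IsNoetherianRing A] {z : A} (h : LocSeq (Submonoid.powers z) i p j q)
    {𝔪 𝔟 : Ideal A} [𝔪.IsMaximal] (hz : z ∈ 𝔪) {n : ℕ} (hn : 𝔪 ^ n ≤ 𝔟 ⊔ Ideal.span {z})
    (ht : ITor 𝔟 X) (h0 : (noe A ⊥).mem (EX A (A ⧸ 𝔪) X 0))
    (h1 : (noe A ⊥).mem (EX A (A ⧸ 𝔪) X 1)) :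
    (art A ⊥).mem G ∧ (art A ⊥).mem H ∧ ∀ n, (noe A ⊥).mem (EX A (A ⧸ 𝔪) X n) := by
  have hzS : z ∈ Submonoid.powers z := Submonoid.mem_powers z
  have hzN : z ∈ Module.annihilator A (A ⧸ 𝔪) := by rwa [Ideal.annihilator_quotient]
  have aG : (art A ⊥).mem G := by
    refine art_of_ext0 (𝔟 := 𝔪) HCond.of_max ?_ ((noe A ⊥).of_inj _ (EX.post_inj i h.s1.inj) h0)
    exact ((h.torG ht).sup (ITor.of_tor h.tG)).of_pow_le hn
  have eG : ∀ n, (noe A ⊥).mem (EX A (A ⧸ 𝔪) G n) := noe_ext_of_art HCond.of_max aG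
  have eB1 : (noe A ⊥).mem (EX A (A ⧸ 𝔪) B 1) :=
    (noe A ⊥).mid _ _ (EX.co3 h.s1 _ 1) h1 (eG 2)
  have aH : (art A ⊥).mem H := by
    refine art_of_ext0 (𝔟 := 𝔪) HCond.of_max ?_ (h.extH hzS hzN _ 0 eB1)
    exact ((h.torH ht).sup (ITor.of_tor h.tH)).of_pow_le hn
  refine ⟨aG, aH, fun n => (noe A ⊥).mid _ _ (EX.co2 h.s1 _ n) (eG n) ?_⟩
  cases n with
  | zero => exact h.extB0 hzS hzN _
  | succ n => exact h.extB hzS hzN _ n (noe_ext_of_art HCond.of_max aH n)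

theorem LocSeq.ar_half [IsNoetherianRing A] {z : A} (h : LocSeq (Submonoid.powers z) i p j q)
    {𝔪 𝔟 𝔞 : Ideal A} [𝔪.IsMaximal] (hz : z ∈ 𝔪) {n : ℕ} (hn : 𝔪 ^ n ≤ 𝔟 ⊔ Ideal.span {z})
    (hab : 𝔞 ≤ 𝔟)
    (ht : ITor 𝔟 X) (h0 : (noe A ⊥).mem (EX A (A ⧸ 𝔪) X 0))
    (h1 : (noe A ⊥).mem (EX A (A ⧸ 𝔪) X 1)) (ha : (art A (Submonoid.powers z)).mem X) (k : ℕ) :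
    AR 𝔞 (k + 2) X := by
  obtain ⟨aG, aH, -⟩ := h.half hz hn ht h0 h1
  have hta := ht.mono hab
  exact h.ar (AR.of_art (SInv.bot _) (h.torG hta) aG _)
    (AR.of_art h.inv (h.torY hta) (h.artY ha) _) (AR.of_art (SInv.bot _) (h.torH hta) aH _)

/-- the main computation -/
theorem AR.core [IsNoetherianRing A] {𝔪 𝔞 J 𝔟₁ : Ideal A} [𝔪.IsMaximal] {y z : A}
    (h : LocSeq (Submonoid.powers y) i p j q) (hJ : J ≤ Module.annihilator A X) (ht : ITor 𝔞 X)
    (ham : 𝔞 ≤ 𝔪) (hy : y ∈ 𝔪) (hz : z ∈ 𝔪) (hb : 𝔟₁ = 𝔞 ⊔ J ⊔ Ideal.span {y})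
    {n : ℕ} (hn : 𝔪 ^ n ≤ 𝔟₁ ⊔ Ideal.span {z}) (hc : HCond1 (Submonoid.powers y) (𝔞 ⊔ J))
    (hcz : HCond (Submonoid.powers z) 𝔟₁)
    (hX : ∀ n ≤ 2, Module.Finite A (EX A (A ⧸ 𝔞) X n)) (k : ℕ) : AR 𝔞 (k + 3) X := by
  have hyS : y ∈ Submonoid.powers y := Submonoid.mem_powers y
  have hyN : y ∈ Module.annihilator A (A ⧸ 𝔪) := by rwa [Ideal.annihilator_quotient]
  have hyb : y ∈ 𝔟₁ := hb ▸ Ideal.mem_sup_right (Ideal.mem_span_singleton_self y)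
  have hyN' : y ∈ Module.annihilator A (A ⧸ 𝔟₁) := by rwa [Ideal.annihilator_quotient]
  have hab : 𝔞 ≤ 𝔟₁ := hb ▸ le_sup_left.trans le_sup_left
  have heX : ∀ (𝔠 : Ideal A), 𝔞 ≤ 𝔠 → ∀ n ≤ 2, Module.Finite A (EX A (A ⧸ 𝔠) X n) := by
    intro 𝔠 hac n hn
    refine (SerreCl.fin A).ext_of_pow 𝔞 2 hX n hn _ 1 ?_
    rw [Ideal.annihilator_quotient, pow_one]
    exact hac
  have eX : ∀ n ≤ 2, (noe A ⊥).mem (EX A (A ⧸ 𝔪) X n) := fun n hn =>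
    noe_of_finite _ (heX 𝔪 ham n hn)
  have tG : ITor 𝔟₁ G := by
    rw [hb]
    exact ((h.torG ht).sup (ITor.of_ann (hJ.trans h.annG))).sup (ITor.of_tor h.tG)
  have tH : ITor 𝔟₁ H := by
    rw [hb]
    exact ((h.torH ht).sup (ITor.of_ann (hJ.trans h.annH))).sup (ITor.of_tor h.tH)
  have eG0 : (noe A ⊥).mem (EX A (A ⧸ 𝔪) G 0) :=
    (noe A ⊥).of_inj _ (EX.post_inj i h.s1.inj) (eX 0 (by lia))
  have eG1 : (noe A ⊥).mem (EX A (A ⧸ 𝔪) G 1) :=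
    (noe A ⊥).mid _ _ (EX.co1 h.s1 _ 0) (h.extB0 hyS hyN _) (eX 1 (by lia))
  have eG : ∀ n, (noe A ⊥).mem (EX A (A ⧸ 𝔪) G n) :=
    ((locSeq (Submonoid.powers z) G).half hz hn tG eG0 eG1).2.2
  have eB : ∀ n ≤ 2, (noe A ⊥).mem (EX A (A ⧸ 𝔪) B n) := fun n hn =>
    (noe A ⊥).mid _ _ (EX.co3 h.s1 _ n) (eX n hn) (eG (n + 1))
  have aG : (art A (Submonoid.powers z)).mem G := by
    refine art_of_ext0 hcz tG ((noe A _).of_inj _ (EX.post_inj i h.s1.inj)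
      (noe_of_finite _ (heX 𝔟₁ hab 0 (by lia))))
  have aH : (art A (Submonoid.powers z)).mem H := by
    refine art_of_ext0 hcz tH (h.extH hyS hyN' _ 0 ?_)
    exact (noe A _).mid _ _ (EX.co3 h.s1 _ 1) (noe_of_finite _ (heX 𝔟₁ hab 1 (by lia)))
      (noe_ext_of_art hcz aG 2)
  refine h.ar ?_ ?_ ?_
  · exact (locSeq (Submonoid.powers z) G).ar_half hz hn hab tG eG0 eG1 aG (k + 1)
  · exact AR.BN (𝔟 := 𝔞 ⊔ J) rfl (hJ.trans h.annY) h.inv (h.torY ht) hc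
      (h.noeY _ 0 (noe_of_finite _ (hX 0 (by lia)))) (h.noeY _ 1 (noe_of_finite _ (hX 1 (by lia))))
      (k + 1)
  · exact (locSeq (Submonoid.powers z) H).ar_half hz hn hab tH (h.extH hyS hyN _ 0 (eB 1 (by lia)))
      (h.extH hyS hyN _ 1 (eB 2 (by lia))) aH k

end LocSec

/-! ### The criterion in dimension at most three -/

theorem exists_avoid [IsNoetherianRing A] [IsLocalRing A] (𝔟 : Ideal A) :
    ∃ y ∈ IsLocalRing.maximalIdeal A, ∀ q ∈ 𝔟.minimalPrimes, q ≠ IsLocalRing.maximalIdeal A →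
      y ∉ q := by
  classical
  by_contra! hcon
  have hfin := Ideal.finite_minimalPrimes_of_isNoetherianRing A 𝔟
  have hsub : (IsLocalRing.maximalIdeal A : Set A) ⊆
      ⋃ q ∈ (↑(hfin.toFinset.filter (fun q => q ≠ IsLocalRing.maximalIdeal A)) :
        Set (Ideal A)), (q : Set A) := by
    intro x hx
    obtain ⟨q, hq, hqm, hxq⟩ := hcon x hx
    simp only [Set.mem_iUnion]
    exact ⟨q, Finset.mem_coe.2 (Finset.mem_filter.2 ⟨hfin.mem_toFinset.2 hq, hqm⟩), hxq⟩
  obtain ⟨q, hq, hle⟩ := (Ideal.subset_union_prime (f := fun q : Ideal A => q) ⊥ ⊥ (by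
    intro q hq _ _
    exact (hfin.mem_toFinset.1 (Finset.mem_filter.1 hq).1).1.1)).1 hsub
  obtain ⟨hq, hqm⟩ := Finset.mem_filter.1 hq
  have hp : q.IsPrime := (hfin.mem_toFinset.1 hq).1.1
  exact hqm (le_antisymm (IsLocalRing.le_maximalIdeal hp.ne_top) hle)

theorem exists_colon [IsNoetherianRing A] (I 𝔞 : Ideal A) :
    ∃ (n : ℕ) (J : Ideal A), I ≤ J ∧ (∀ a ∈ 𝔞 ^ n, ∀ u ∈ J, u * a ∈ I) ∧
      ∀ (k : ℕ) (u : A), (∀ a ∈ 𝔞 ^ k, u * a ∈ I) → u ∈ J := by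
  let F : ℕ →o Ideal A := ⟨fun k => Submodule.colon I (𝔞 ^ k : Ideal A), by
    intro k l hkl u hu
    rw [Submodule.mem_colon] at hu ⊢
    intro a ha
    exact hu a (Ideal.pow_le_pow_right hkl ha)⟩
  obtain ⟨n, hn⟩ := monotone_stabilizes_iff_noetherian.2 ‹IsNoetherianRing A› F
  refine ⟨n, F n, ?_, ?_, ?_⟩
  · intro u hu
    refine Submodule.mem_colon.2 fun a _ => ?_
    exact Ideal.mul_mem_right _ _ hu
  · intro a ha u hu
    exact Submodule.mem_colon.1 hu a ha
  · intro k u hu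
    have h1 : u ∈ F k := Submodule.mem_colon.2 hu
    have h2 : u ∈ F (max n k) := F.monotone (le_max_right n k) h1
    rwa [← hn _ (le_max_left n k)] at h2

theorem exists_lt_prime [IsNoetherianRing A] {I 𝔞 J : Ideal A}
    (hJ : ∀ (k : ℕ) (u : A), (∀ a ∈ 𝔞 ^ k, u * a ∈ I) → u ∈ J) (hIJ : I ≤ J)
    (p : Ideal A) (hp : p.IsPrime) (hap : 𝔞 ⊔ J ≤ p) : ∃ p' : Ideal A, p'.IsPrime ∧ I ≤ p' ∧ p' < p := by
  classical
  have hIp : I ≤ p := hIJ.trans (le_sup_right.trans hap)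
  obtain ⟨q, hq, hqp⟩ := Ideal.exists_minimalPrimes_le hIp
  by_cases hne : q = p
  swap
  · exact ⟨q, hq.1.1, hq.1.2, lt_of_le_of_ne hqp hne⟩
  subst hne
  exfalso
  have hfin := Ideal.finite_minimalPrimes_of_isNoetherianRing A I
  have h1 : ¬ ((hfin.toFinset.erase q).inf id ≤ q) := by
    intro hle
    obtain ⟨r, hr, hrq⟩ := (Ideal.IsPrime.inf_le' hp).1 hle
    obtain ⟨hrne, hr⟩ := Finset.mem_erase.1 hr
    have hr := hfin.mem_toFinset.1 hr
    exact hrne (le_antisymm hrq (hq.2 hr.1 hrq))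
  obtain ⟨u, hu, huq⟩ := SetLike.not_le_iff_exists.1 h1
  have h2 : Ideal.span {u} * q ≤ I.radical := by
    rw [← Ideal.sInf_minimalPrimes]
    refine le_sInf fun r hr => ?_
    by_cases hrq : r = q
    · subst hrq
      exact Ideal.mul_le_right
    · refine Ideal.mul_le_left.trans ?_
      rw [Ideal.span_singleton_le_iff_mem]
      exact (Finset.inf_le (f := id) (Finset.mem_erase.2 ⟨hrq, hfin.mem_toFinset.2 hr⟩)) hu
  obtain ⟨k, hk⟩ := Ideal.exists_pow_le_of_le_radical_of_fg h2 (IsNoetherian.noetherian _)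
  have h3 : u ^ k ∈ J := by
    refine hJ k _ fun a ha => hk ?_
    rw [mul_pow]
    exact Ideal.mul_mem_mul (Ideal.pow_mem_pow (Ideal.mem_span_singleton_self u) k)
      (Ideal.pow_right_mono (le_sup_left.trans hap) k ha)
  exact huq (hp.mem_of_pow_mem k (hap (Ideal.mem_sup_right h3)))

theorem no_chain4 {I : Ideal A} (hdim : ringKrullDim (A ⧸ I) ≤ 3)
    (p0 p1 p2 p3 p4 : Ideal A) (h0 : p0.IsPrime) (h1 : p1.IsPrime) (h2 : p2.IsPrime)
    (h3 : p3.IsPrime) (h4 : p4.IsPrime) (hI : I ≤ p0) (h01 : p0 < p1) (h12 : p1 < p2)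
    (h23 : p2 < p3) (h34 : p3 < p4) : False := by
  rw [ringKrullDim_quotient] at hdim
  let q0 : ↑(PrimeSpectrum.zeroLocus (I : Set A)) := ⟨⟨p0, h0⟩, hI⟩
  let q1 : ↑(PrimeSpectrum.zeroLocus (I : Set A)) := ⟨⟨p1, h1⟩, hI.trans h01.le⟩
  let q2 : ↑(PrimeSpectrum.zeroLocus (I : Set A)) := ⟨⟨p2, h2⟩, hI.trans (h01.trans h12).le⟩
  let q3 : ↑(PrimeSpectrum.zeroLocus (I : Set A)) :=
    ⟨⟨p3, h3⟩, hI.trans (h01.trans (h12.trans h23)).le⟩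
  let q4 : ↑(PrimeSpectrum.zeroLocus (I : Set A)) :=
    ⟨⟨p4, h4⟩, hI.trans (h01.trans (h12.trans (h23.trans h34))).le⟩
  have hl := Order.LTSeries.length_le_krullDim (α := ↑(PrimeSpectrum.zeroLocus (I : Set A)))
    ⟨4, ![q0, q1, q2, q3, q4], by
      intro i
      fin_cases i
      · exact h01
      · exact h12
      · exact h23
      · exact h34⟩
  have := hl.trans hdim
  change ((4 : ℕ) : WithBot ℕ∞) ≤ ((3 : ℕ) : WithBot ℕ∞) at this
  norm_cast at this

theorem exists_params [IsNoetherianRing A] [IsLocalRing A] {𝔟 : Ideal A}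
    (hc : ∀ p0 p1 p2 p3 : Ideal A, p0.IsPrime → p1.IsPrime → p2.IsPrime → p3.IsPrime →
      𝔟 ≤ p0 → p0 < p1 → p1 < p2 → p2 < p3 → False) :
    ∃ y z : A, y ∈ IsLocalRing.maximalIdeal A ∧ z ∈ IsLocalRing.maximalIdeal A ∧
      HCond1 (Submonoid.powers y) 𝔟 ∧ HCond (Submonoid.powers z) (𝔟 ⊔ Ideal.span {y}) ∧
      ∃ n : ℕ, IsLocalRing.maximalIdeal A ^ n ≤ 𝔟 ⊔ Ideal.span {y} ⊔ Ideal.span {z} := by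
  obtain ⟨y, hy, hyq⟩ := exists_avoid 𝔟
  obtain ⟨z, hz, hzq⟩ := exists_avoid (𝔟 ⊔ Ideal.span {y})
  have hmp : (IsLocalRing.maximalIdeal A).IsPrime := inferInstance
  have hlt : ∀ (w : A) (p : Ideal A), p.IsPrime → w ∈ IsLocalRing.maximalIdeal A → w ∉ p →
      p < IsLocalRing.maximalIdeal A := by
    intro w p hp hw hwp
    refine lt_of_le_of_ne (IsLocalRing.le_maximalIdeal hp.ne_top) ?_
    rintro rfl
    exact hwp hw
  have hstep : ∀ (c : Ideal A) (w : A), (∀ q ∈ c.minimalPrimes, q ≠ IsLocalRing.maximalIdeal A →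
      w ∉ q) → ∀ p : Ideal A, p.IsPrime → p ≠ IsLocalRing.maximalIdeal A →
      c ⊔ Ideal.span {w} ≤ p → ∃ q : Ideal A, q.IsPrime ∧ c ≤ q ∧ q < p := by
    intro c w hcw p hp hpm hle
    obtain ⟨q, hq, hqp⟩ := Ideal.exists_minimalPrimes_le (le_sup_left.trans hle)
    have hw : w ∈ p := hle (Ideal.mem_sup_right (Ideal.mem_span_singleton_self w))
    have hqm : q ≠ IsLocalRing.maximalIdeal A := by
      rintro rfl
      exact hpm (le_antisymm (IsLocalRing.le_maximalIdeal hp.ne_top) hqp)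
    refine ⟨q, hq.1.1, hq.1.2, lt_of_le_of_ne hqp ?_⟩
    rintro rfl
    exact hcw _ hq hqm hw
  have hc3 : ∀ p0 p1 p2 : Ideal A, p0.IsPrime → p1.IsPrime → p2.IsPrime →
      𝔟 ⊔ Ideal.span {y} ≤ p0 → p0 < p1 → p1 < p2 → False := by
    intro p0 p1 p2 h0 h1 h2 hb h01 h12
    have hne : p0 ≠ IsLocalRing.maximalIdeal A := by
      rintro rfl
      exact absurd (IsLocalRing.le_maximalIdeal h1.ne_top) (not_le_of_gt h01)
    obtain ⟨q, hq, hbq, hqp⟩ := hstep 𝔟 y hyq p0 h0 hne hb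
    exact hc q p0 p1 p2 hq h0 h1 h2 hbq hqp h01 h12
  refine ⟨y, z, hy, hz, ?_, ?_, ?_⟩
  · intro p q r hp hq hr hbp hpq hqr
    refine ⟨y, Submonoid.mem_powers y, ?_⟩
    by_contra hyr
    exact hc p q r _ hp hq hr hmp hbp hpq hqr (hlt y r hr hy hyr)
  · intro p q hp hq hbp hpq hs
    by_contra hne
    exact hc3 p q _ hp hq hmp hbp (lt_of_le_of_ne hpq hne)
      (hlt z q hq hz (hs z (Submonoid.mem_powers z)))
  · refine Ideal.exists_pow_le_of_le_radical_of_fg ?_ (IsNoetherian.noetherian _)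
    rw [Ideal.radical_eq_sInf]
    refine le_sInf ?_
    rintro p ⟨hle, hp⟩
    by_contra hne
    have hpm : p ≠ IsLocalRing.maximalIdeal A := by
      rintro rfl
      exact hne le_rfl
    obtain ⟨q, hq, hbq, hqp⟩ := hstep _ z hzq p hp hpm hle
    exact hc3 q p _ hq hp hmp hbq hqp
      (lt_of_le_of_ne (IsLocalRing.le_maximalIdeal hp.ne_top) hpm)

theorem criterion [IsNoetherianRing A] [IsLocalRing A] (𝔞 I : Ideal A)
    (hdim : ringKrullDim (A ⧸ I) ≤ 3) (H : Type) [AddCommGroup H] [Module A H]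
    (hI : I ≤ Module.annihilator A H) (ht : ITor 𝔞 H)
    (hX : ∀ n ≤ 2, Module.Finite A (EX A (A ⧸ 𝔞) H n)) (i : ℕ) :
    Module.Finite A (EX A (A ⧸ 𝔞) H i) := by
  by_cases ham : 𝔞 ≤ IsLocalRing.maximalIdeal A
  swap
  · have htop : 𝔞 = ⊤ := by
      by_contra h
      exact ham (IsLocalRing.le_maximalIdeal h)
    subst htop
    have : Subsingleton (A ⧸ (⊤ : Ideal A)) := Submodule.Quotient.subsingleton_iff.2 rfl
    have : Subsingleton (EX A (A ⧸ (⊤ : Ideal A)) H i) :=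
      ⟨fun a b => by rw [EX.eq_zero_of_subsingleton_left i a, EX.eq_zero_of_subsingleton_left i b]⟩
    infer_instance
  obtain ⟨n, J, hIJ, hn, hJ⟩ := exists_colon I 𝔞
  -- the submodule killed by `J`
  let L := tsub J H
  have hpow : Module.Finite A (tsub (𝔞 ^ n) H) := by
    refine (SerreCl.fin A).of_equiv (EX.tsubEquiv (𝔞 ^ n) H) ?_
    refine (SerreCl.fin A).ext_of_pow 𝔞 0 (fun j hj => hX j (by omega)) 0 le_rfl _ n ?_
    exact (Ideal.annihilator_quotient (I := 𝔞 ^ n)).ge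
  have hQ : Module.Finite A (H ⧸ L) := by
    obtain ⟨s, hs⟩ := (IsNoetherian.noetherian J : J.FG)
    have hsJ : ∀ r ∈ s, r ∈ J := fun r hr => hs ▸ Ideal.subset_span hr
    let f : H →ₗ[A] (s → tsub (𝔞 ^ n) H) := LinearMap.pi fun r =>
      LinearMap.codRestrict _ (LinearMap.lsmul A H r.1) (by
        intro h
        refine mem_tsub.2 fun a ha => ?_
        have := Module.mem_annihilator.1 (hI (hn a ha r.1 (hsJ _ r.2))) h
        rw [mul_comm, mul_smul] at this
        exact this)
    have hker : LinearMap.ker f ≤ L := by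
      intro h hh
      refine mem_tsub.2 fun a ha => ?_
      have h1 : J ≤ LinearMap.ker (LinearMap.toSpanSingleton A H h) := by
        rw [← hs]
        refine Submodule.span_le.2 fun r hr => ?_
        have := congrFun (LinearMap.mem_ker.1 hh) ⟨r, hr⟩
        exact congrArg Subtype.val this
      exact h1 ha
    have : Module.Finite A (LinearMap.range f) := inferInstance
    have h2 : Module.Finite A (H ⧸ LinearMap.ker f) :=
      Module.Finite.equiv f.quotKerEquivRange.symm
    exact Module.Finite.of_surjective _ (Submodule.factor_surjective hker)
  have hses : SES L.subtype L.mkQ := SES.quot L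
  have hXQ : ∀ j, Module.Finite A (EX A (A ⧸ 𝔞) (H ⧸ L) j) :=
    fun j => (SerreCl.fin A).ext hQ j _
  have hXL : ∀ j ≤ 2, Module.Finite A (EX A (A ⧸ 𝔞) L j) := by
    intro j hj
    cases j with
    | zero =>
      exact (SerreCl.fin A).of_inj (EX.post _ L.subtype 0) (EX.post_inj _ L.subtype_injective)
        (hX 0 hj)
    | succ j =>
      exact (SerreCl.fin A).mid _ _ (EX.co1 hses _ j) (hXQ j) (hX _ hj)
  have hL : ∀ j, Module.Finite A (EX A (A ⧸ 𝔞) L j) := by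
    have hJL : J ≤ Module.annihilator A L := le_ann_tsub J
    have hc : ∀ p0 p1 p2 p3 : Ideal A, p0.IsPrime → p1.IsPrime → p2.IsPrime → p3.IsPrime →
        𝔞 ⊔ J ≤ p0 → p0 < p1 → p1 < p2 → p2 < p3 → False := by
      intro p0 p1 p2 p3 h0 h1 h2 h3 hle h01 h12 h23
      obtain ⟨q, hq, hIq, hlt⟩ := exists_lt_prime hJ hIJ p0 h0 hle
      exact no_chain4 hdim q p0 p1 p2 p3 hq h0 h1 h2 h3 hIq hlt h01 h12 h23
    obtain ⟨y, z, hy, hz, hc1, hc2, m, hm⟩ := exists_params hc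
    have hAR : ∀ k, AR 𝔞 (k + 3) L := fun k =>
      AR.core (locSeq (Submonoid.powers y) L) hJL
        (ITor.of_inj L.subtype L.subtype_injective ht) ham hy hz rfl hm hc1 hc2 hXL k
    refine AR.mem_all (SerreCl.fin A) 2 (fun j hj => ?_) hXL
    obtain ⟨k, rfl⟩ := Nat.exists_eq_add_of_le hj
    have := hAR k
    rwa [show 2 + k + 1 = k + 3 by omega]
  exact (SerreCl.fin A).mid _ _ (EX.co2 hses _ i) (hL i) (hXQ i)

/-! ### Comparison of the two definitions of `Ext` -/

section ExtComparison

variable {X Y : ModuleCat.{0} A} (R : ProjectiveResolution X)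

theorem extMk_zero_iff (f : R.complex.X 0 ⟶ Y) (m : ℕ) (hm : 0 + 1 = m)
    (hf : R.complex.d m 0 ≫ f = 0) : R.extMk f m hm hf = 0 ↔ f = 0 := by
  constructor
  swap
  · rintro rfl
    simp
  intro h
  rw [← R.extEquivCohomologyClass.apply_eq_iff_eq,
    ProjectiveResolution.extEquivCohomologyClass_extMk,
    ProjectiveResolution.extEquivCohomologyClass_zero,
    CochainComplex.HomComplex.CohomologyClass.mk_eq_zero_iff,
    CochainComplex.HomComplex.Cocycle.toSingleMk_mem_coboundaries_iff _ _ _ _ _ 1 (by simp)] at h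
  obtain ⟨g, hg⟩ := h
  have hz : g = 0 := (R.cochainComplex.isZero_of_isStrictlyLE 0 1 (by simp)).eq_of_src _ _
  rw [hz, comp_zero] at hg
  rw [← cancel_epi (R.cochainComplexXIso (-(0 : ℕ)) 0 rfl).hom]
  simpa using hg.symm

/-- the map from cocycles to `Ext`. -/
def extMkLin (n m : ℕ) (hm : n + 1 = m) :
    LinearMap.ker ((Linear.leftComp A Y (R.complex.d m n))) →ₗ[A] Abelian.Ext X Y n where
  toFun f := R.extMk f.1 m hm f.2
  map_add' f g := (R.add_extMk _ _ _ _ _ _).symm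
  map_smul' a f := by
    have := R.extMk_comp_mk₀ f.1 m hm f.2 (a • 𝟙 Y)
    simp only [RingHom.id_apply]
    simp [Abelian.Ext.mk₀_smul] at this
    exact this.symm

theorem extMkLin_surj (n m : ℕ) (hm : n + 1 = m) :
    Function.Surjective (extMkLin (Y := Y) R n m hm) := by
  intro a
  obtain ⟨f, hf, h⟩ := R.extMk_surjective a m hm
  exact ⟨⟨f, hf⟩, h⟩

theorem extCompare (n : ℕ) :
    Nonempty ((((_root_.Ext A (ModuleCat A) n).obj (Opposite.op X)).obj Y : ModuleCat A) ≃ₗ[A]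
      Abelian.Ext X Y n) := by
  let R := projectiveResolution X
  let K := R.complex.linearYonedaObj A Y
  let S := K.sc n
  have hm : n + 1 = (ComplexShape.up ℕ).next n := (CochainComplex.next ℕ n).symm
  let F : LinearMap.ker S.g.hom →ₗ[A] Abelian.Ext X Y n :=
    { toFun := fun f => extMkLin R n _ hm ⟨f.1, f.2⟩
      map_add' := fun f g => (extMkLin R n _ hm).map_add ⟨f.1, f.2⟩ ⟨g.1, g.2⟩
      map_smul' := fun a f => (extMkLin R n _ hm).map_smul a ⟨f.1, f.2⟩ }
  have hF : Function.Surjective F := by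
    intro a
    obtain ⟨f, hf⟩ := extMkLin_surj R n _ hm a
    exact ⟨⟨f.1, f.2⟩, hf⟩
  have hker : LinearMap.range S.moduleCatToCycles = LinearMap.ker F := by
    ext f
    cases n with
    | zero =>
      have h1 : f ∈ LinearMap.ker F ↔ (f.1 : R.complex.X 0 ⟶ Y) = 0 :=
        extMk_zero_iff R f.1 _ hm f.2
      have hp : ¬ (ComplexShape.up ℕ).Rel ((ComplexShape.up ℕ).prev 0) 0 := by simp
      have h0 : S.f = 0 := K.shape _ _ hp
      rw [h1]
      constructor
      · rintro ⟨g, rfl⟩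
        change S.f.hom g = 0
        rw [h0]
        rfl
      · intro h
        exact ⟨0, Subtype.ext (by rw [map_zero]; exact h.symm)⟩
    | succ k =>
      have hp : (ComplexShape.up ℕ).prev (k + 1) + 1 = k + 1 := by simp
      have h1 : f ∈ LinearMap.ker F ↔ _ := R.extMk_eq_zero_iff f.1 _ hm f.2 _ hp
      rw [h1]
      constructor
      · rintro ⟨g, rfl⟩
        exact ⟨g, rfl⟩
      · rintro ⟨g, h⟩
        exact ⟨g, Subtype.ext h⟩
  exact ⟨((R.isoExt n Y).toLinearEquiv.trans S.moduleCatHomologyIso.toLinearEquiv).trans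
    ((Submodule.quotEquivOfEq _ _ hker).trans (F.quotKerEquivOfSurjective hF))⟩

end ExtComparison

theorem finite_extQuot_iff (𝔞 : Ideal A) (M : Type) [AddCommGroup M] [Module A M] (i : ℕ) :
    Module.Finite A (extQuot 𝔞 M i) ↔ Module.Finite A (EX A (A ⧸ 𝔞) M i) := by
  obtain ⟨e⟩ := extCompare (A := A) (X := ModuleCat.of A (A ⧸ 𝔞)) (Y := ModuleCat.of A M) i
  exact ⟨fun _ => Module.Finite.equiv e, fun _ => Module.Finite.equiv e.symm⟩

/-! ### Koszul signs -/

/-- Koszul sign -/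
def ksgn (A : Type) [CommRing A] {t : ℕ} (s : Finset (Fin t)) (j : Fin t) : A :=
  (-1 : A) ^ ((s.filter (fun k => k < j)).card)

theorem ksgn_sq {t : ℕ} (s : Finset (Fin t)) (j : Fin t) : ksgn A s j * ksgn A s j = 1 := by
  rw [ksgn, ← mul_pow]
  simp

theorem ksgn_erase {t : ℕ} (s : Finset (Fin t)) (j : Fin t) :
    ksgn A (s.erase j) j = ksgn A s j := by
  rw [ksgn, ksgn, Finset.filter_erase, Finset.erase_eq_of_notMem (by simp)]

theorem ksgn_erase_of_lt {t : ℕ} {s : Finset (Fin t)} {j k : Fin t} (hj : j ∈ s) (h : j < k) :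
    ksgn A s k = - ksgn A (s.erase j) k := by
  rw [ksgn, ksgn, Finset.filter_erase,
    ← Finset.card_erase_add_one (s := s.filter (fun l => l < k)) (a := j) (by simp [hj, h]), pow_succ]
  ring

theorem ksgn_erase_of_gt {t : ℕ} {s : Finset (Fin t)} {j k : Fin t} (h : k < j) :
    ksgn A (s.erase j) k = ksgn A s k := by
  rw [ksgn, ksgn, Finset.filter_erase, Finset.erase_eq_of_notMem (by simp [h.le])]

theorem ksgn_swap {t : ℕ} {s : Finset (Fin t)} {j k : Fin t} (hj : j ∈ s) (hk : k ∈ s)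
    (hjk : j ≠ k) :
    ksgn A s j * ksgn A (s.erase j) k = - (ksgn A s k * ksgn A (s.erase k) j) := by
  rcases lt_or_gt_of_ne hjk with h | h
  · rw [ksgn_erase_of_lt (A := A) hj h, ksgn_erase_of_gt (A := A) h]
    ring
  · rw [ksgn_erase_of_lt (A := A) hk h, ksgn_erase_of_gt (A := A) h]
    ring

/-! ### The Koszul complex -/

section KoszulSec

variable {t : ℕ} (x : Fin t → A) (M : Type) [AddCommGroup M] [Module A M]

/-- extension by zero -/
def kext {i : ℕ} (f : KoszulCochain x M i) (s : Finset (Fin t)) : M :=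
  if h : s.card = i then f ⟨s, h⟩ else 0

theorem kext_mk {i : ℕ} (f : KoszulCochain x M i) (s : Finset (Fin t)) (h : s.card = i) :
    kext x M f s = f ⟨s, h⟩ := dif_pos h

theorem koszulD_apply {i : ℕ} (f : KoszulCochain x M i)
    (s : {s : Finset (Fin t) // s.card = i + 1}) :
    koszulD x M i f s = ∑ j ∈ s.1, (ksgn A s.1 j * x j) • kext x M f (s.1.erase j) := by
  rw [← Finset.sum_attach]
  simp only [koszulD, LinearMap.pi_apply, LinearMap.sum_apply, LinearMap.smul_apply,
    LinearMap.proj_apply]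
  refine Finset.sum_congr rfl fun j _ => ?_
  rw [kext_mk x M f (s.1.erase j.1) (by simp [Finset.card_erase_of_mem j.2, s.2])]
  rfl

theorem koszulD_koszulD {i : ℕ} (f : KoszulCochain x M i) :
    koszulD x M (i + 1) (koszulD x M i f) = 0 := by
  ext s
  rw [koszulD_apply]
  have h1 : ∀ j ∈ s.1, (ksgn A s.1 j * x j) • kext x M (koszulD x M i f) (s.1.erase j) =
      ∑ k ∈ s.1.erase j, (ksgn A s.1 j * ksgn A (s.1.erase j) k * (x j * x k)) •
        kext x M f ((s.1.erase j).erase k) := by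
    intro j hj
    rw [kext_mk x M _ (s.1.erase j) (by simp [Finset.card_erase_of_mem hj, s.2]), koszulD_apply,
      Finset.smul_sum]
    refine Finset.sum_congr rfl fun k _ => ?_
    rw [smul_smul]
    congr 1
    ring
  rw [Finset.sum_congr rfl h1]
  rw [← Finset.sum_finset_product' s.1.offDiag s.1 (fun j => s.1.erase j)
    (by
      rintro ⟨j, k⟩
      simp only [Finset.mem_offDiag, Finset.mem_erase]
      tauto)
    (f := fun j k => (ksgn A s.1 j * ksgn A (s.1.erase j) k * (x j * x k)) •
        kext x M f ((s.1.erase j).erase k))]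
  refine Finset.sum_involution (fun a _ => a.swap) ?_ ?_ ?_ ?_
  · rintro ⟨j, k⟩ h
    obtain ⟨hj, hk, hjk⟩ := Finset.mem_offDiag.1 h
    simp only [Prod.swap]
    rw [ksgn_swap hj hk hjk, Finset.erase_right_comm, ← add_smul]
    convert zero_smul A _
    ring
  · rintro ⟨j, k⟩ h _ heq
    obtain ⟨hj, hk, hjk⟩ := Finset.mem_offDiag.1 h
    exact hjk (congrArg Prod.snd heq)
  · rintro ⟨j, k⟩ h
    obtain ⟨hj, hk, hjk⟩ := Finset.mem_offDiag.1 h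
    exact Finset.mem_offDiag.2 ⟨hk, hj, hjk.symm⟩
  · rintro ⟨j, k⟩ h
    rfl

/-- the homotopy -/
def khom (j : Fin t) {i : ℕ} (f : KoszulCochain x M (i + 1)) : KoszulCochain x M i :=
  fun s => if j ∈ s.1 then 0 else ksgn A s.1 j • kext x M f (insert j s.1)

theorem smul_cocycle_mem (j : Fin t) (i : ℕ) (f : KoszulCochain x M i)
    (hf : koszulD x M i f = 0) : x j • f ∈ koszulBoundary x M i := by
  -- the value of the differential on `insert j s`
  have key : ∀ s : {s : Finset (Fin t) // s.card = i}, j ∉ s.1 →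
      x j • f s = - ∑ k ∈ s.1, (ksgn A s.1 j * ksgn A (insert j s.1) k * x k) •
        kext x M f (insert j (s.1.erase k)) := by
    intro s hjs
    have h1 := congrFun hf ⟨insert j s.1, by rw [Finset.card_insert_of_notMem hjs, s.2]⟩
    rw [koszulD_apply, Finset.sum_insert hjs] at h1
    simp only [Finset.erase_insert hjs, Pi.zero_apply] at h1
    have h2 := congrArg (fun m => ksgn A s.1 j • m) h1
    simp only [smul_add, smul_zero, smul_smul, Finset.smul_sum] at h2
    have h3 : ksgn A (insert j s.1) j = ksgn A s.1 j := by
      rw [← ksgn_erase, Finset.erase_insert hjs]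
    rw [h3, ← mul_assoc, ksgn_sq, one_mul, kext_mk x M f s.1 s.2] at h2
    rw [eq_neg_iff_add_eq_zero, ← h2]
    congr 1
    refine Finset.sum_congr rfl fun k hk => ?_
    rw [Finset.erase_insert_of_ne (by rintro rfl; exact hjs hk), mul_assoc]
  cases i with
  | zero =>
    change x j • f ∈ (⊥ : Submodule A (KoszulCochain x M 0))
    rw [Submodule.mem_bot]
    ext s
    have hs : s.1 = ∅ := Finset.card_eq_zero.1 s.2
    have := key s (by simp [hs])
    rw [hs] at this
    simpa using this
  | succ i =>
    refine ⟨khom x M j f, ?_⟩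
    ext s
    rw [koszulD_apply]
    by_cases hjs : j ∈ s.1
    · rw [Finset.sum_eq_single_of_mem j hjs]
      · rw [kext_mk x M _ (s.1.erase j) (by simp [Finset.card_erase_of_mem hjs, s.2])]
        simp only [khom, Finset.notMem_erase, if_false, Finset.insert_erase hjs]
        rw [kext_mk x M f s.1 s.2, ksgn_erase, smul_smul, mul_right_comm, ksgn_sq, one_mul]
        rfl
      · intro k hk hkj
        rw [kext_mk x M _ (s.1.erase k) (by simp [Finset.card_erase_of_mem hk, s.2])]
        simp [khom, Finset.mem_erase, hjs, hkj.symm]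
    · change _ = x j • f s
      rw [key s hjs, ← Finset.sum_neg_distrib]
      refine Finset.sum_congr rfl fun k hk => ?_
      have hkj : k ≠ j := by
        rintro rfl
        exact hjs hk
      rw [kext_mk x M _ (s.1.erase k) (by simp [Finset.card_erase_of_mem hk, s.2])]
      simp only [khom, Finset.mem_erase, hjs, and_false, if_false]
      rw [smul_smul, ← neg_smul]
      congr 1
      have h4 := ksgn_swap (A := A) (s := insert j s.1) (j := k) (k := j)
        (Finset.mem_insert_of_mem hk) (Finset.mem_insert_self _ _) hkj
      have h3 : ksgn A (insert j s.1) j = ksgn A s.1 j := by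
        rw [← ksgn_erase, Finset.erase_insert hjs]
      have h5 : ksgn A ((insert j s.1).erase k) j = ksgn A (s.1.erase k) j := by
        rw [Finset.erase_insert_of_ne hkj.symm, ← ksgn_erase, Finset.erase_insert]
        simp [hjs]
      rw [h3, h5, Finset.erase_insert hjs] at h4
      have h6 := ksgn_sq (A := A) s.1 j
      have h7 := ksgn_sq (A := A) (s.1.erase k) j
      generalize ksgn A s.1 j = a at *
      generalize ksgn A s.1 k = b at *
      generalize ksgn A (insert j s.1) k = c at *
      generalize ksgn A (s.1.erase k) j = d at *
      linear_combination (x k * a * d) * h4 - (x k * a * c) * h7 - (x k * (b * d)) * h6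

end KoszulSec

/-! ### Assembly -/

theorem support_iff_ITor [IsNoetherianRing A] (𝔞 : Ideal A) (M : Type) [AddCommGroup M]
    [Module A M] : Module.support A M ⊆ PrimeSpectrum.zeroLocus (𝔞 : Set A) ↔ ITor 𝔞 M := by
  constructor
  · intro h m
    have h1 : 𝔞 ≤ (Submodule.span A {m}).annihilator.radical := by
      rw [Ideal.radical_eq_sInf]
      refine le_sInf ?_
      rintro p ⟨hle, hp⟩
      exact h (Module.mem_support_iff_exists_annihilator.2 ⟨m, hle⟩ :
        (⟨p, hp⟩ : PrimeSpectrum A) ∈ _)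
    obtain ⟨n, hn⟩ := Ideal.exists_pow_le_of_le_radical_of_fg h1 (IsNoetherian.noetherian _)
    exact ⟨n, fun a ha => (Submodule.mem_annihilator_span_singleton _ _).1 (hn ha)⟩
  · intro h p hp
    obtain ⟨m, hm⟩ := Module.mem_support_iff_exists_annihilator.1 hp
    obtain ⟨n, hn⟩ := h m
    have : 𝔞 ^ n ≤ p.asIdeal := fun a ha =>
      hm ((Submodule.mem_annihilator_span_singleton _ _).2 (hn a ha))
    exact p.2.le_of_pow_le this

theorem ITor.pi {𝔞 : Ideal A} {M : Type} [AddCommGroup M] [Module A M] (h : ITor 𝔞 M)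
    (ι : Type) [Finite ι] : ITor 𝔞 (ι → M) := by
  classical
  cases nonempty_fintype ι
  intro m
  choose n hn using fun i => h (m i)
  refine ⟨Finset.univ.sup n, fun a ha => ?_⟩
  ext i
  exact hn i a (Ideal.pow_le_pow_right (Finset.le_sup (Finset.mem_univ i)) ha)

theorem isCofinite_iff [IsNoetherianRing A] (𝔞 : Ideal A) (M : Type) [AddCommGroup M]
    [Module A M] :
    IsCofinite 𝔞 M ↔ ITor 𝔞 M ∧ ∀ i, Module.Finite A (EX A (A ⧸ 𝔞) M i) := by
  rw [IsCofinite, support_iff_ITor]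
  simp only [finite_extQuot_iff]

section FinEx

variable {N M' M M'' : Type} [AddCommGroup N] [Module A N] [AddCommGroup M'] [Module A M']
  [AddCommGroup M] [Module A M] [AddCommGroup M''] [Module A M'']

theorem fin_of_subsingleton (N M : Type) [AddCommGroup N] [Module A N] [AddCommGroup M]
    [Module A M] [Subsingleton M] (i : ℕ) : Module.Finite A (EX A N M i) := by
  have : Subsingleton (EX A N M i) :=
    ⟨fun a b => by rw [EX.eq_zero_of_subsingleton_right i a, EX.eq_zero_of_subsingleton_right i b]⟩
  infer_instance

variable [IsNoetherianRing A] {f : M' →ₗ[A] M} {g : M →ₗ[A] M''}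

theorem SES.finMid (h : SES f g) (i : ℕ) (h1 : Module.Finite A (EX A N M' i))
    (h2 : Module.Finite A (EX A N M'' i)) : Module.Finite A (EX A N M i) :=
  (SerreCl.fin A).mid _ _ (EX.co2 h N i) h1 h2

theorem SES.finRight (h : SES f g) (i : ℕ) (h1 : Module.Finite A (EX A N M i))
    (h2 : Module.Finite A (EX A N M' (i + 1))) : Module.Finite A (EX A N M'' i) :=
  (SerreCl.fin A).mid _ _ (EX.co3 h N i) h1 h2

theorem SES.finLeft (h : SES f g) (i : ℕ) (h1 : Module.Finite A (EX A N M'' i))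
    (h2 : Module.Finite A (EX A N M (i + 1))) : Module.Finite A (EX A N M' (i + 1)) :=
  (SerreCl.fin A).mid _ _ (EX.co1 h N i) h1 h2

theorem SES.finLeft0 (h : SES f g) (h2 : Module.Finite A (EX A N M 0)) :
    Module.Finite A (EX A N M' 0) :=
  (SerreCl.fin A).of_inj (EX.post _ f 0) (EX.post_inj _ h.inj) h2

theorem fin_pi (i : ℕ) (hM : Module.Finite A (EX A N M i)) (ι : Type) [Finite ι] :
    Module.Finite A (EX A N (ι → M) i) := by
  have h1 : ∀ s : ℕ, Module.Finite A (EX A N (Fin s → M) i) := by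
    intro s
    induction s with
    | zero => exact fin_of_subsingleton _ _ _
    | succ s ih =>
      have h2 : Module.Finite A (EX A N (M × (Fin s → M)) i) :=
        SES.finMid (f := LinearMap.inl A M (Fin s → M)) (g := LinearMap.snd A M (Fin s → M))
          ⟨LinearMap.inl_injective, Function.Exact.inl_snd, LinearMap.snd_surjective⟩ i hM ih
      exact Module.Finite.equiv
        (EX.postEquiv N (Fin.consLinearEquiv A (fun _ : Fin (s + 1) => M)) i)
  have h2 := h1 (Nat.card ι)
  exact Module.Finite.equiv (EX.postEquiv N (LinearEquiv.funCongrLeft A M (Finite.equivFin ι)) i)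

end FinEx

section Main

variable {t : ℕ} (x : Fin t → A) (M : Type) [AddCommGroup M] [Module A M]

theorem koszulBoundary_le (i : ℕ) : koszulBoundary x M i ≤ LinearMap.ker (koszulD x M i) := by
  cases i with
  | zero => exact bot_le
  | succ i =>
    rintro _ ⟨f, rfl⟩
    exact koszulD_koszulD x M f

/-- The inclusion of cohomology into the cokernel. -/
def kIncl (i : ℕ) : KoszulCohomology x M i →ₗ[A] KoszulCochain x M i ⧸ koszulBoundary x M i :=
  Submodule.mapQ _ _ (LinearMap.ker (koszulD x M i)).subtype le_rfl

/-- The map from the cokernel to the next boundaries. -/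
def kProj (i : ℕ) :
    (KoszulCochain x M i ⧸ koszulBoundary x M i) →ₗ[A] koszulBoundary x M (i + 1) :=
  Submodule.liftQ _ (LinearMap.codRestrict (koszulBoundary x M (i + 1)) (koszulD x M i)
    (fun f => ⟨f, rfl⟩)) (by
      intro f hf
      exact Subtype.ext (koszulBoundary_le x M i hf))

theorem kSES (i : ℕ) : SES (kIncl x M i) (kProj x M i) := by
  refine ⟨?_, ?_, ?_⟩
  · rw [← LinearMap.ker_eq_bot, LinearMap.ker_eq_bot']
    intro m hm
    obtain ⟨z, rfl⟩ := Submodule.Quotient.mk_surjective _ m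
    have hm : Submodule.Quotient.mk z.1 = (0 : KoszulCochain x M i ⧸ koszulBoundary x M i) := hm
    rw [Submodule.Quotient.mk_eq_zero] at hm ⊢
    exact hm
  · intro m
    obtain ⟨z, rfl⟩ := Submodule.Quotient.mk_surjective _ m
    constructor
    · intro h
      exact ⟨Submodule.Quotient.mk ⟨z, congrArg Subtype.val h⟩, rfl⟩
    · rintro ⟨w, hw⟩
      obtain ⟨w, rfl⟩ := Submodule.Quotient.mk_surjective _ w
      rw [← hw]
      exact Subtype.ext w.2
  · rintro ⟨_, f, rfl⟩
    exact ⟨Submodule.Quotient.mk f, rfl⟩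

theorem span_le_annihilator (i : ℕ) :
    Ideal.span (Set.range x) ≤ Module.annihilator A (KoszulCohomology x M i) := by
  rw [Ideal.span_le]
  rintro _ ⟨j, rfl⟩
  refine Module.mem_annihilator.2 fun m => ?_
  obtain ⟨z, rfl⟩ := Submodule.Quotient.mk_surjective _ m
  rw [← Submodule.Quotient.mk_smul, Submodule.Quotient.mk_eq_zero]
  exact smul_cocycle_mem x M j i z.1 z.2

variable {x M} {𝔞 : Ideal A} [IsNoetherianRing A]

theorem ITor.koszul (h : ITor 𝔞 M) (i : ℕ) : ITor 𝔞 (KoszulCohomology x M i) :=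
  ITor.of_surj (Submodule.mkQ _) (Submodule.mkQ_surjective _)
    (ITor.of_inj (Submodule.subtype _) (Submodule.subtype_injective _) (h.pi _))

theorem fin_boundary (hM : ∀ i, Module.Finite A (EX A (A ⧸ 𝔞) M i)) (n : ℕ)
    (hH : ∀ i < n, ∀ j, Module.Finite A (EX A (A ⧸ 𝔞) (KoszulCohomology x M i) j)) (j : ℕ) :
    Module.Finite A (EX A (A ⧸ 𝔞) (koszulBoundary x M n) j) := by
  induction n generalizing j with
  | zero =>
    have : Subsingleton (koszulBoundary x M 0) :=
      inferInstanceAs (Subsingleton (⊥ : Submodule A (KoszulCochain x M 0)))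
    exact fin_of_subsingleton _ _ _
  | succ n ih =>
    have ih := ih (fun i hi => hH i (by omega))
    refine (kSES x M n).finRight j ?_ (hH n (by omega) _)
    exact (SES.quot (koszulBoundary x M n)).finRight j (fin_pi j (hM j) _) (ih _)

theorem fin_coker (hM : ∀ i, Module.Finite A (EX A (A ⧸ 𝔞) M i)) (n : ℕ)
    (hH : ∀ i < n, ∀ j, Module.Finite A (EX A (A ⧸ 𝔞) (KoszulCohomology x M i) j)) (j : ℕ) :
    Module.Finite A (EX A (A ⧸ 𝔞) (KoszulCochain x M n ⧸ koszulBoundary x M n) j) :=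
  (SES.quot (koszulBoundary x M n)).finRight j (fin_pi j (hM j) _) (fin_boundary hM n hH _)

theorem fin_boundary0 (hM : ∀ i, Module.Finite A (EX A (A ⧸ 𝔞) M i)) (n : ℕ) :
    Module.Finite A (EX A (A ⧸ 𝔞) (koszulBoundary x M n) 0) :=
  (SES.quot (koszulBoundary x M n)).finLeft0 (fin_pi 0 (hM 0) _)

theorem fin_H0 (hM : ∀ i, Module.Finite A (EX A (A ⧸ 𝔞) M i)) (n : ℕ)
    (hH : ∀ i < n, ∀ j, Module.Finite A (EX A (A ⧸ 𝔞) (KoszulCohomology x M i) j)) :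
    Module.Finite A (EX A (A ⧸ 𝔞) (KoszulCohomology x M n) 0) :=
  (kSES x M n).finLeft0 (fin_coker hM n hH 0)

theorem fin_H012 (hM : ∀ i, Module.Finite A (EX A (A ⧸ 𝔞) M i)) (n : ℕ)
    (hH : ∀ i < n, ∀ j, Module.Finite A (EX A (A ⧸ 𝔞) (KoszulCohomology x M i) j))
    (h0 : Module.Finite A (EX A (A ⧸ 𝔞) (KoszulCohomology x M (n + 1)) 0)) (j : ℕ) (hj : j ≤ 2) :
    Module.Finite A (EX A (A ⧸ 𝔞) (KoszulCohomology x M n) j) := by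
  have hC := fin_coker hM n hH
  have hC1 : Module.Finite A
      (EX A (A ⧸ 𝔞) (KoszulCochain x M (n + 1) ⧸ koszulBoundary x M (n + 1)) 0) :=
    (kSES x M (n + 1)).finMid 0 h0 (fin_boundary0 hM _)
  have hB1 : Module.Finite A (EX A (A ⧸ 𝔞) (koszulBoundary x M (n + 1)) 1) :=
    (SES.quot (koszulBoundary x M (n + 1))).finLeft 0 hC1 (fin_pi 1 (hM 1) _)
  obtain rfl | rfl | rfl : j = 0 ∨ j = 1 ∨ j = 2 := by omega
  · exact fin_H0 hM n hH
  · exact (kSES x M n).finLeft 0 (fin_boundary0 hM _) (hC 1)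
  · exact (kSES x M n).finLeft 1 hB1 (hC 2)

end Main

theorem fin_hom_iff (𝔞 : Ideal A) (M : Type) [AddCommGroup M] [Module A M] :
    Module.Finite A ((A ⧸ 𝔞) →ₗ[A] M) ↔ Module.Finite A (EX A (A ⧸ 𝔞) M 0) :=
  ⟨fun _ => Module.Finite.equiv EX.zeroEquiv.symm, fun _ => Module.Finite.equiv EX.zeroEquiv⟩

/-- If `A` is local, `dim A/(x) ≤ 3`, and `M` is `𝔞`-cofinite, then
`Hom_A(A/𝔞, H^i(x,M))` is finitely generated for all `i ≤ n + 1` iff `H^i(x,M)` is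
`𝔞`-cofinite for all `i ≤ n`. -/
theorem stmt18 [IsNoetherianRing A] [IsLocalRing A] (𝔞 : Ideal A)
    {t : ℕ} (x : Fin t → A)
    (hdim : ringKrullDim (A ⧸ Ideal.span (Set.range x)) ≤ 3)
    (M : Type) [AddCommGroup M] [Module A M] (hM : IsCofinite 𝔞 M) (n : ℕ) :
    (∀ i ≤ n + 1, Module.Finite A ((A ⧸ 𝔞) →ₗ[A] KoszulCohomology x M i)) ↔
      (∀ i ≤ n, IsCofinite 𝔞 (KoszulCohomology x M i)) := by
  obtain ⟨ht, hM⟩ := (isCofinite_iff 𝔞 M).1 hM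
  constructor
  · intro h i
    induction i using Nat.strong_induction_on with
    | _ i ih =>
      intro hi
      refine (isCofinite_iff 𝔞 _).2 ⟨ht.koszul i, ?_⟩
      refine criterion 𝔞 _ hdim _ (span_le_annihilator x M i) (ht.koszul i) ?_
      refine fin_H012 hM i (fun k hk => ((isCofinite_iff 𝔞 _).1 (ih k hk (by omega))).2) ?_
      exact (fin_hom_iff 𝔞 _).1 (h (i + 1) (by omega))
  · intro h i hi
    exact (fin_hom_iff 𝔞 _).2
      (fin_H0 hM i fun k hk => ((isCofinite_iff 𝔞 _).1 (h k (by omega))).2)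

end
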